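/- (Spectral resolution theorem) Let E be a σ-lattice effect algebra. If x is an observable on E and x_t := x((-∞, t)), then: x_t ≤ x_s for t < s; ⋀_t x_t = 0 and ⋁_t x_t = 1; and ⋁_{t<s} x_t = x_s for each s ∈ ℝ. Conversely, every system {x_t : t ∈ ℝ} in E satisfying these three conditions arises from a unique observable x with x((-∞,t)) = x_t for all t. -/

import Mathlib

structure EffectAlgebra (E : Type*) where
  add : E → E → Option E
  zero : E
  one : E
  comm : ∀ a b, add a b = add b a
  assoc : ∀ a b c, (add a b).bind (fun d => add d c) = (add b c).bind (fun d => add a d)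
  orth : ∀ a : E, ∃! b, add a b = some one
  pos_one : ∀ a b, add a one = some b → a = zero

namespace EffectAlgebra

variable {E : Type*}

/-- The induced order: `a ≤ b` iff `a + c = b` for some `c`. -/
def le (EA : EffectAlgebra E) (a b : E) : Prop := ∃ c, EA.add a c = some b

/-- The orthosupplement `a'`, the unique element with `a + a' = 1`. -/
noncomputable def orthosupp (EA : EffectAlgebra E) (a : E) : E :=
  Classical.choose (EA.orth a).exists

/-- `s` is the supremum of `S` with respect to the induced order. -/
def IsSup (EA : EffectAlgebra E) (S : Set E) (s : E) : Prop :=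
  (∀ x ∈ S, EA.le x s) ∧ ∀ b, (∀ x ∈ S, EA.le x b) → EA.le s b

/-- `s` is the infimum of `S` with respect to the induced order. -/
def IsInf (EA : EffectAlgebra E) (S : Set E) (s : E) : Prop :=
  (∀ x ∈ S, EA.le s x) ∧ ∀ b, (∀ x ∈ S, EA.le b x) → EA.le b s

/-- Every increasing sequence has a supremum. -/
def MonotoneSigmaComplete (EA : EffectAlgebra E) : Prop :=
  ∀ f : ℕ → E, (∀ n, EA.le (f n) (f (n + 1))) → ∃ s, EA.IsSup (Set.range f) s

/-- A σ-lattice effect algebra: countable suprema and infima exist. -/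
def SigmaLattice (EA : EffectAlgebra E) : Prop :=
  (∀ f : ℕ → E, ∃ s, EA.IsSup (Set.range f) s) ∧
  (∀ f : ℕ → E, ∃ s, EA.IsInf (Set.range f) s)

/-- A complete lattice effect algebra: arbitrary suprema and infima exist. -/
def CompleteEA (EA : EffectAlgebra E) : Prop :=
  (∀ S : Set E, ∃ s, EA.IsSup S s) ∧ (∀ S : Set E, ∃ s, EA.IsInf S s)

/-- A lattice effect algebra: binary suprema and infima exist. -/
def LatticeEA (EA : EffectAlgebra E) : Prop :=
  (∀ a b : E, ∃ s, EA.IsSup {a, b} s) ∧ (∀ a b : E, ∃ s, EA.IsInf {a, b} s)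

end EffectAlgebra

/-- Borel subsets of the real line. -/
abbrev BorelSet := {A : Set ℝ // MeasurableSet A}

def bIio (t : ℝ) : BorelSet := ⟨Set.Iio t, measurableSet_Iio⟩
def bIic (t : ℝ) : BorelSet := ⟨Set.Iic t, measurableSet_Iic⟩

/-- An observable on a (monotone σ-complete) effect algebra: a unital,
additive map on the Borel σ-algebra preserving suprema of increasing sequences. -/
structure Observable {E : Type*} (EA : EffectAlgebra E) where
  toFun : BorelSet → E
  unital : toFun ⟨Set.univ, MeasurableSet.univ⟩ = EA.one
  additive : ∀ A B : BorelSet, Disjoint A.1 B.1 →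
    EA.add (toFun A) (toFun B) = some (toFun ⟨A.1 ∪ B.1, A.2.union B.2⟩)
  sup_cont : ∀ f : ℕ → BorelSet, (∀ n, (f n).1 ⊆ (f (n + 1)).1) →
    EA.IsSup (Set.range fun n => toFun (f n))
      (toFun ⟨⋃ n, (f n).1, MeasurableSet.iUnion (fun n => (f n).2)⟩)

namespace Observable

variable {E : Type*} {EA : EffectAlgebra E}

/-- The Olson (spectral) order on observables. -/
def OlsonLe (x y : Observable EA) : Prop :=
  ∀ t : ℝ, EA.le (y.toFun (bIio t)) (x.toFun (bIio t))

/-- An observable is bounded if `x(C) = 1` for some compact set `C`. -/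
def Bounded (x : Observable EA) : Prop :=
  ∃ C : Set ℝ, ∃ hC : IsCompact C, x.toFun ⟨C, hC.measurableSet⟩ = EA.one

/-- `x` is the question observable `q_a` of the element `a`. -/
def IsQuestion (x : Observable EA) (a : E) : Prop :=
  ∀ t : ℝ, x.toFun (bIio t) =
    if t ≤ 0 then EA.zero else if t ≤ 1 then EA.orthosupp a else EA.one

/-- The spectrum of `x` lies in `[0,1]`. -/
def SpectrumIn01 (x : Observable EA) : Prop :=
  x.toFun ⟨Set.Icc 0 1, measurableSet_Icc⟩ = EA.one

/-- `z` is the infimum of `S` in the Olson order on bounded observables. -/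
def IsOlsonInf (S : Set (Observable EA)) (z : Observable EA) : Prop :=
  z.Bounded ∧ (∀ x ∈ S, z.OlsonLe x) ∧
    ∀ w : Observable EA, w.Bounded → (∀ x ∈ S, w.OlsonLe x) → w.OlsonLe z

/-- `z` is the supremum of `S` in the Olson order on bounded observables. -/
def IsOlsonSup (S : Set (Observable EA)) (z : Observable EA) : Prop :=
  z.Bounded ∧ (∀ x ∈ S, x.OlsonLe z) ∧
    ∀ w : Observable EA, w.Bounded → (∀ x ∈ S, x.OlsonLe w) → z.OlsonLe w

end Observable

/-- A spectral resolution: monotone, with infimum 0, supremum 1, left continuous. -/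
def SpectralResolution {E : Type*} (EA : EffectAlgebra E) (F : ℝ → E) : Prop :=
  (∀ t s : ℝ, t < s → EA.le (F t) (F s)) ∧
  EA.IsInf (Set.range F) EA.zero ∧
  EA.IsSup (Set.range F) EA.one ∧
  ∀ s : ℝ, EA.IsSup (F '' Set.Iio s) (F s)

/-- A bounded commutative BCK-algebra, i.e. an MV-algebra presented by its truncated difference. -/
class BoundedBCK (M : Type*) extends Sub M, Zero M, One M where
  sub_right_comm' : ∀ a b c : M, a - b - c = a - c - b
  sub_sub_comm' : ∀ a b : M, a - (a - b) = b - (b - a)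
  sub_self' : ∀ a : M, a - a = 0
  sub_zero' : ∀ a : M, a - 0 = a
  zero_sub' : ∀ a : M, 0 - a = 0
  sub_one' : ∀ a : M, a - 1 = 0

namespace BoundedBCK

variable {M : Type*} [BoundedBCK M]

instance : PartialOrder M where
  le a b := a - b = 0
  le_refl := sub_self'
  le_trans a b c hab hbc := by
    change a - b = 0 at hab
    change b - c = 0 at hbc
    have h := sub_sub_comm' a b
    rw [hab, sub_zero'] at h
    rw [h, sub_right_comm', hbc, zero_sub']
  le_antisymm a b hab hba := by
    change a - b = 0 at hab
    change b - a = 0 at hba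
    have h := sub_sub_comm' a b
    rwa [hab, hba, sub_zero', sub_zero'] at h

theorem le_iff {a b : M} : a ≤ b ↔ a - b = 0 := Iff.rfl

theorem le_one (a : M) : a ≤ 1 := sub_one' a

theorem zero_le' (a : M) : 0 ≤ a := zero_sub' a

theorem sub_sub_of_le {a b : M} (h : b ≤ a) : a - (a - b) = b := by
  rw [sub_sub_comm', le_iff.1 h, sub_zero']

theorem compl_compl (a : M) : 1 - (1 - a) = a := sub_sub_of_le (le_one a)

/-- Truncated addition. -/
instance : Add M := ⟨fun a b => 1 - (1 - a - b)⟩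

theorem add_def (a b : M) : a + b = 1 - (1 - a - b) := rfl

theorem compl_add (a b : M) : 1 - (a + b) = 1 - a - b := by
  rw [add_def, compl_compl]

theorem add_comm' (a b : M) : a + b = b + a := by
  rw [add_def, add_def, sub_right_comm']

instance : AddCommMonoid M where
  add_assoc a b c := by
    rw [add_def (a + b), compl_add, add_comm' a, add_def (b + c), compl_add, sub_right_comm' 1 a b,
      sub_right_comm' (1 - b) a c]
  zero_add a := by rw [add_def, sub_zero', compl_compl]
  add_zero a := by rw [add_def, sub_zero', compl_compl]
  add_comm := add_comm'
  nsmul := nsmulRec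

theorem sub_add_eq (a b c : M) : a - (b + c) = a - b - c := by
  rw [← compl_compl a, sub_right_comm' 1 (1 - a) (b + c), compl_add, sub_right_comm' 1 (1 - a) b,
    sub_right_comm' (1 - b) (1 - a) c]

instance : OrderedSub M where
  tsub_le_iff_right a b c := by
    rw [le_iff, le_iff, add_comm' c b, sub_add_eq]

theorem sub_le_sub_right' {a b : M} (h : a ≤ b) (c : M) : a - c ≤ b - c := by
  rw [← sub_sub_of_le h, sub_right_comm', le_iff, sub_right_comm', sub_self', zero_sub']

theorem sub_le_self' (a b : M) : a - b ≤ a := by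
  rw [le_iff, sub_right_comm', sub_self', zero_sub']

theorem sub_le_comm' {a b c : M} (h : a - b ≤ c) : a - c ≤ b := by
  rw [le_iff] at *; rwa [sub_right_comm']

theorem sub_le_sub_left' {a b : M} (h : a ≤ b) (c : M) : c - b ≤ c - a :=
  sub_le_comm' ((sub_sub_comm' c a).trans_le (sub_le_self' a _) |>.trans h)

theorem le_self_add' (a b : M) : a ≤ a + b := by
  rw [le_iff, sub_add_eq, sub_self', zero_sub']

theorem add_sub_cancel_of_le' {a b : M} (h : a ≤ b) : a + (b - a) = b := by
  have h1 : 1 - b ≤ 1 - a := sub_le_sub_left' h 1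
  have h2 : b - a = 1 - a - (1 - b) := by
    rw [sub_right_comm', compl_compl]
  rw [add_def, h2, sub_sub_of_le h1, compl_compl]

instance : IsOrderedAddMonoid M where
  add_le_add_left a b h c := by
    rw [add_def, add_def]
    exact sub_le_sub_left' (sub_le_sub_right' (sub_le_sub_left' h 1) c) 1

instance : CanonicallyOrderedAdd M where
  exists_add_of_le {a b} h := ⟨b - a, (add_sub_cancel_of_le' h).symm⟩
  le_self_add := le_self_add'
  le_add_self a b := by rw [add_comm']; exact le_self_add' a b

/-- Addition is cancelled when it does not overflow. -/
theorem add_sub_cancel_left_of_le {a b : M} (h : b ≤ 1 - a) : a + b - a = b := by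
  rw [add_def, sub_right_comm', sub_sub_of_le h]

theorem le_compl_comm {a b : M} (h : a ≤ 1 - b) : b ≤ 1 - a := by
  rw [← compl_compl b]; exact sub_le_sub_left' h 1

/-- The meet. -/
def meet (a b : M) : M := a - (a - b)

theorem meet_comm (a b : M) : meet a b = meet b a := sub_sub_comm' a b

theorem meet_le_left (a b : M) : meet a b ≤ a := sub_le_self' a _

theorem meet_le_right (a b : M) : meet a b ≤ b := meet_comm a b ▸ meet_le_left b a

theorem le_meet {a b c : M} (hb : a ≤ b) (hc : a ≤ c) : a ≤ meet b c := by
  rw [← sub_sub_of_le hb]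
  exact sub_le_sub_left' (sub_le_sub_left' hc b) b

theorem sub_meet (a b : M) : a - meet a b = a - b :=
  sub_sub_of_le (sub_le_self' a b)

theorem sub_eq_of_meet_eq_zero {a b : M} (h : meet a b = 0) : a - b = a := by
  rw [← sub_meet, h, sub_zero']

theorem meet_add_eq_zero {e a b : M} (ha : meet e a = 0) (hb : meet e b = 0) :
    meet e (a + b) = 0 := by
  rw [meet, sub_add_eq, sub_eq_of_meet_eq_zero ha, sub_eq_of_meet_eq_zero hb, sub_self']

theorem eq_zero_of_le_zero {a : M} (h : a ≤ 0) : a = 0 := le_antisymm h (zero_le' a)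

theorem meet_eq_zero_mono {a b c d : M} (h : meet a b = 0) (hc : c ≤ a) (hd : d ≤ b) :
    meet c d = 0 :=
  eq_zero_of_le_zero
    (h ▸ le_meet ((meet_le_left c d).trans hc) ((meet_le_right c d).trans hd))

theorem meet_sub_sub (a b : M) : meet (a - b) (b - a) = 0 := by
  set w := meet (a - b) (b - a) with hw
  set z := meet a b with hz
  have hwa : w ≤ a - z := by rw [hz, sub_meet]; exact meet_le_left _ _
  have hwb : w ≤ b - z := by rw [hz, meet_comm, sub_meet]; exact meet_le_right _ _
  have key : ∀ c : M, z ≤ c → w ≤ c - z → w + z ≤ c := by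
    intro c hzc hwc
    have h1 : z ≤ c - w := by
      rw [← sub_sub_of_le hzc]; exact sub_le_sub_left' hwc c
    calc w + z ≤ w + (c - w) := by gcongr
      _ = c := add_sub_cancel_of_le' (hwc.trans (sub_le_self' c z))
  have h2 : w + z ≤ z :=
    le_meet (key a (meet_le_left a b) hwa) (key b (meet_le_right a b) hwb)
  have h3 : w ≤ 1 - z := hwa.trans (sub_le_sub_right' (le_one a) z)
  rw [← add_sub_cancel_left_of_le h3, add_comm']
  exact le_iff.1 h2

theorem sub_sub_sub_le (a b c : M) : (c - a) - (c - b) ≤ b - a := by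
  rw [sub_right_comm', sub_sub_comm' c b]
  exact sub_le_sub_right' (sub_le_self' b _) a

theorem sub_sub_sub_le_right (a b c : M) : (a - c) - (b - c) ≤ a - b :=
  tsub_le_iff_right.2 tsub_le_tsub_add_tsub

/-- A state: a normalized additive functional. -/
structure IsState (p : M → ℝ) : Prop where
  nonneg : ∀ a, 0 ≤ p a
  one : p 1 = 1
  add : ∀ a b, a ≤ 1 - b → p (a + b) = p a + p b

namespace IsState

variable {p : M → ℝ}

theorem zero (hp : IsState p) : p 0 = 0 := by
  have := hp.add 0 0 (zero_le' _)
  rw [add_zero] at this; linarith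

theorem sub (hp : IsState p) {a b : M} (h : a ≤ b) : p (b - a) = p b - p a := by
  have h1 := hp.add (b - a) a (sub_le_sub_right' (le_one b) a)
  rw [add_comm', add_sub_cancel_of_le' h] at h1
  linarith

theorem mono (hp : IsState p) {a b : M} (h : a ≤ b) : p a ≤ p b := by
  have := hp.nonneg (b - a)
  rw [hp.sub h] at this; linarith

theorem le_one (hp : IsState p) (a : M) : p a ≤ 1 := hp.one ▸ hp.mono (BoundedBCK.le_one a)

theorem add_le (hp : IsState p) (a b : M) : p (a + b) ≤ p a + p b := by
  have h : a + b = a + meet (1 - a) b := by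
    rw [add_def, add_def, meet, sub_sub_of_le (sub_le_self' _ b)]
  rw [h, hp.add _ _ (le_compl_comm (meet_le_left _ _))]
  have := hp.mono (meet_le_right (1 - a) b)
  linarith

theorem nsmul_le (hp : IsState p) (n : ℕ) (a : M) : p (n • a) ≤ n * p a := by
  induction n with
  | zero => simp [hp.zero]
  | succ n ih =>
    rw [succ_nsmul]
    have := hp.add_le (n • a) a
    push_cast; linarith

end IsState

section Chain

open Classical in
/-- One step of adding `a` modulo one, counting the overflows. -/
noncomputable def overflowStep (a : M) (x : ℕ ×ₗ M) : ℕ ×ₗ M :=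
  if (ofLex x).2 ≤ 1 - a then toLex ((ofLex x).1, (ofLex x).2 + a)
  else toLex ((ofLex x).1 + 1, (ofLex x).2 - (1 - a))

theorem overflowStep_of_le {a r : M} (k : ℕ) (h : r ≤ 1 - a) :
    overflowStep a (toLex (k, r)) = toLex (k, r + a) := if_pos h

theorem overflowStep_of_not_le {a r : M} (k : ℕ) (h : ¬ r ≤ 1 - a) :
    overflowStep a (toLex (k, r)) = toLex (k + 1, r - (1 - a)) := if_neg h

theorem overflowStep_add (htot : ∀ a b : M, a ≤ b ∨ b ≤ a) {a b : M} (hab : a ≤ 1 - b)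
    (x : ℕ ×ₗ M) : overflowStep (a + b) x = overflowStep a (overflowStep b x) := by
  obtain ⟨k, r⟩ := x
  change overflowStep (a + b) (toLex (k, r)) = overflowStep a (overflowStep b (toLex (k, r)))
  have hc : 1 - (a + b) = 1 - b - a := by rw [add_comm', compl_add]
  by_cases h1 : r ≤ 1 - b
  · rw [overflowStep_of_le k h1]
    by_cases h2 : r + b ≤ 1 - a
    · have h3 : r ≤ 1 - (a + b) := by
        rw [compl_add, ← add_sub_cancel_left_of_le h1, add_comm' b r]
        exact sub_le_sub_right' h2 b
      rw [overflowStep_of_le k h2, overflowStep_of_le k h3, add_assoc, add_comm' a b]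
    · have h3 : ¬ r ≤ 1 - (a + b) := by
        intro h
        refine h2 ?_
        rw [compl_add] at h
        calc r + b ≤ 1 - a - b + b := by gcongr
          _ = 1 - a := by rw [add_comm', add_sub_cancel_of_le' (le_compl_comm hab)]
      rw [overflowStep_of_not_le k h2, overflowStep_of_not_le k h3]
      congr 2
      have h4 : 1 - (a + b) ≤ r := (htot _ _).resolve_left h3
      have h5 : 1 - a = (1 - (a + b)) + b := by
        rw [compl_add, add_comm', add_sub_cancel_of_le' (le_compl_comm hab)]
      rw [h5, add_comm' r b, add_comm' (1 - (a + b)) b, sub_add_eq (b + r),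
        add_sub_cancel_left_of_le h1]
  · have h4 : 1 - b ≤ r := (htot _ _).resolve_left h1
    have h2 : r - (1 - b) ≤ 1 - a :=
      (sub_le_sub_right' (le_one r) _).trans (by rw [compl_compl]; exact le_compl_comm hab)
    have h3 : ¬ r ≤ 1 - (a + b) := fun h => h1 (h.trans (by rw [hc]; exact sub_le_self' _ _))
    rw [overflowStep_of_not_le k h1, overflowStep_of_le _ h2, overflowStep_of_not_le k h3]
    congr 2
    rw [hc]
    have h5 : r - (1 - b) + a + (1 - b - a) = r := by
      rw [add_assoc, add_sub_cancel_of_le' hab, add_comm', add_sub_cancel_of_le' h4]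
    have h6 : r - (1 - b) + a ≤ 1 - (1 - b - a) := by
      rw [← hc, compl_compl, add_comm' a b]
      gcongr
      exact (sub_le_sub_right' (le_one r) _).trans (compl_compl b).le
    conv_lhs => rw [← h5, add_comm']
    exact add_sub_cancel_left_of_le h6

theorem overflowStep_mono (a : M) : Monotone (overflowStep a) := by
  rintro ⟨k, r⟩ ⟨l, s⟩ h
  change toLex (k, r) ≤ toLex (l, s) at h
  change overflowStep a (toLex (k, r)) ≤ overflowStep a (toLex (l, s))
  rw [Prod.Lex.le_iff] at h
  by_cases h1 : r ≤ 1 - a <;> by_cases h2 : s ≤ 1 - a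
  · rw [overflowStep_of_le _ h1, overflowStep_of_le _ h2, Prod.Lex.le_iff]
    rcases h with h | ⟨h, h'⟩
    · exact Or.inl h
    · exact Or.inr ⟨h, by simpa using add_le_add_left h' a⟩
  · rw [overflowStep_of_le _ h1, overflowStep_of_not_le _ h2, Prod.Lex.le_iff]
    left
    rcases h with h | ⟨h, h'⟩ <;> simp at h ⊢ <;> omega
  · rw [overflowStep_of_not_le _ h1, overflowStep_of_le _ h2, Prod.Lex.le_iff]
    rcases h with h | ⟨h, h'⟩
    · rcases Nat.lt_or_ge (k + 1) l with h3 | h3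
      · exact Or.inl h3
      · right
        simp at h
        refine ⟨by simp; omega, ?_⟩
        calc r - (1 - a) ≤ 1 - (1 - a) := sub_le_sub_right' (le_one r) _
          _ = a := compl_compl a
          _ ≤ s + a := le_add_self
    · exact absurd (h'.trans h2) h1
  · rw [overflowStep_of_not_le _ h1, overflowStep_of_not_le _ h2, Prod.Lex.le_iff]
    rcases h with h | ⟨h, h'⟩
    · left; simpa using h
    · right; exact ⟨by simpa using h, sub_le_sub_right' h' _⟩

theorem overflowStep_shift (a : M) (m k : ℕ) (r : M) :
    overflowStep a (toLex (k + m, r)) =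
      toLex ((ofLex (overflowStep a (toLex (k, r)))).1 + m,
        (ofLex (overflowStep a (toLex (k, r)))).2) := by
  by_cases h : r ≤ 1 - a
  · simp [overflowStep_of_le _ h]
  · simp [overflowStep_of_not_le _ h]; omega

theorem overflowStep_iterate_shift (a : M) (m n k : ℕ) (r : M) :
    (overflowStep a)^[n] (toLex (k + m, r)) =
      toLex ((ofLex ((overflowStep a)^[n] (toLex (k, r)))).1 + m,
        (ofLex ((overflowStep a)^[n] (toLex (k, r)))).2) := by
  induction n with
  | zero => rfl
  | succ n ih =>
    rw [Function.iterate_succ_apply', Function.iterate_succ_apply', ih, overflowStep_shift]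
    rfl

/-- The number of overflows when adding `a` to `1` modulo one `n` times. -/
noncomputable def overflowCount (a : M) (n : ℕ) : ℕ :=
  (ofLex ((overflowStep a)^[n] (toLex (0, 1)))).1

theorem overflowCount_le (a : M) (n : ℕ) : overflowCount a n ≤ n := by
  induction n with
  | zero => rfl
  | succ n ih =>
    unfold overflowCount at *
    rw [Function.iterate_succ_apply']
    set x := (overflowStep a)^[n] (toLex (0, 1))
    obtain ⟨k, r⟩ := x
    change k ≤ n at ih
    change (ofLex (overflowStep a (toLex (k, r)))).1 ≤ n + 1
    by_cases h : r ≤ 1 - a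
    · rw [overflowStep_of_le _ h]; simp; omega
    · rw [overflowStep_of_not_le _ h]; simp; omega

theorem overflowCount_one (h01 : (1 : M) ≠ 0) (n : ℕ) : overflowCount (1 : M) n = n := by
  have : (overflowStep (1 : M))^[n] (toLex (0, 1)) = toLex (n, 1) := by
    induction n with
    | zero => rfl
    | succ n ih =>
      rw [Function.iterate_succ_apply', ih, overflowStep_of_not_le, sub_self', sub_zero']
      rw [sub_self']
      exact fun h => h01 (eq_zero_of_le_zero h)
  rw [overflowCount, this]; rfl

theorem overflowCount_add (htot : ∀ a b : M, a ≤ b ∨ b ≤ a) {a b : M} (hab : a ≤ 1 - b) (n : ℕ) :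
    overflowCount (a + b) n ≤ overflowCount a n + overflowCount b n ∧
      overflowCount a n + overflowCount b n ≤ overflowCount (a + b) n + 1 := by
  have hcomm : Function.Commute (overflowStep a) (overflowStep b) := fun x => by
    rw [← overflowStep_add htot hab, ← overflowStep_add htot (le_compl_comm hab), add_comm']
  have hit : (overflowStep (a + b))^[n] = (overflowStep a)^[n] ∘ (overflowStep b)^[n] := by
    rw [← hcomm.comp_iterate]
    congr 1
    funext x
    exact overflowStep_add htot hab x
  unfold overflowCount
  rw [hit, Function.comp_apply]
  set x := (overflowStep b)^[n] (toLex (0, 1))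
  obtain ⟨k, r⟩ := x
  change (ofLex ((overflowStep a)^[n] (toLex (k, r)))).1 ≤ _ + k ∧
    _ + k ≤ (ofLex ((overflowStep a)^[n] (toLex (k, r)))).1 + 1
  have hfst : ∀ y z : ℕ ×ₗ M, y ≤ z → (ofLex y).1 ≤ (ofLex z).1 := by
    intro y z h
    rw [Prod.Lex.le_iff] at h
    rcases h with h | h
    · exact h.le
    · exact h.1.le
  have hm := (overflowStep_mono a).iterate n
  have hs := fun k => overflowStep_iterate_shift a k n 0 1
  constructor
  · have h1 : toLex (k, r) ≤ toLex (0 + k, (1 : M)) := by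
      rw [Prod.Lex.le_iff]; right; exact ⟨by simp, le_one r⟩
    have := hfst _ _ (hm h1)
    rw [hs] at this
    exact this
  · rcases k with _ | k
    · have h1 : toLex (0, (1 : M)) ≤ toLex (0 + 1, r) := by
        rw [Prod.Lex.le_iff]; left; simp
      have := hfst _ _ (hm h1)
      rw [overflowStep_iterate_shift] at this
      exact this
    · have h1 : toLex (0 + k, (1 : M)) ≤ toLex (k + 1, r) := by
        rw [Prod.Lex.le_iff]; left; simp
      have := hfst _ _ (hm h1)
      rw [hs] at this
      exact Nat.add_le_add_right this 1

theorem exists_isState_of_total (htot : ∀ a b : M, a ≤ b ∨ b ≤ a) (h01 : (1 : M) ≠ 0) :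
    ∃ p : M → ℝ, IsState p := by
  let U : Ultrafilter ℕ := Filter.hyperfilter ℕ
  have hU : (U : Filter ℕ) ≤ Filter.atTop := Nat.hyperfilter_le_atTop
  let u : M → ℕ → ℝ := fun a n => overflowCount a n / n
  have hu : ∀ a n, u a n ∈ Set.Icc (0 : ℝ) 1 := fun a n =>
    ⟨by positivity, div_le_one_of_le₀ (by exact_mod_cast overflowCount_le a n) (by positivity)⟩
  have hlim : ∀ a, ∃ x ∈ Set.Icc (0 : ℝ) 1, Filter.Tendsto (u a) U (nhds x) := by
    intro a
    obtain ⟨x, hx, h⟩ := isCompact_Icc.ultrafilter_le_nhds (U.map (u a))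
      (by rw [Filter.le_principal_iff]; exact Filter.mem_map.2 (Filter.Eventually.of_forall (hu a)))
    exact ⟨x, hx, h⟩
  choose p hp hpl using hlim
  refine ⟨p, fun a => (hp a).1, ?_, ?_⟩
  · refine tendsto_nhds_unique (hpl 1) (tendsto_const_nhds.congr' ?_)
    filter_upwards [hU (Filter.eventually_gt_atTop 0)] with n hn
    have : (n : ℝ) ≠ 0 := by exact_mod_cast hn.ne'
    simp only [u, overflowCount_one h01, div_self this]
  · intro a b hab
    have h0 : Filter.Tendsto (fun n => u a n + u b n - u (a + b) n) U (nhds 0) := by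
      have hinv : Filter.Tendsto (fun n : ℕ => (1 : ℝ) / n) U (nhds 0) :=
        tendsto_one_div_atTop_nhds_zero_nat.mono_left hU
      refine tendsto_of_tendsto_of_tendsto_of_le_of_le tendsto_const_nhds hinv ?_ ?_
      · intro n
        have := (overflowCount_add htot hab n).1
        have h : (overflowCount (a + b) n : ℝ) ≤ overflowCount a n + overflowCount b n := by
          exact_mod_cast this
        simp only [u]
        rw [← add_div, ← sub_div]
        exact div_nonneg (by linarith) (by positivity)
      · intro n
        have := (overflowCount_add htot hab n).2
        have h : (overflowCount a n + overflowCount b n : ℝ) ≤ overflowCount (a + b) n + 1 := by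
          exact_mod_cast this
        simp only [u]
        rw [← add_div, ← sub_div]
        exact div_le_div_of_nonneg_right (by linarith) (by positivity)
    have := tendsto_nhds_unique h0 (((hpl a).add (hpl b)).sub (hpl (a + b)))
    linarith

end Chain

section Ultrafilter

/-- Proper filters for the meet. -/
structure IsProperFilter (g : Set M) : Prop where
  up : ∀ a b, a ∈ g → a ≤ b → b ∈ g
  meet_mem : ∀ a b, a ∈ g → b ∈ g → meet a b ∈ g
  zero : (0 : M) ∉ g

/-- Maximal proper filters. -/
structure IsUltra (g : Set M) : Prop extends IsProperFilter g where
  ultra : ∀ a, a ∉ g → ∃ e ∈ g, meet e a = 0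

theorem IsProperFilter.exists_ultra {g : Set M} (hg : IsProperFilter g) (hne : g.Nonempty) :
    ∃ h, g ⊆ h ∧ IsUltra h := by
  obtain ⟨h, hgh, hmax⟩ := zorn_subset_nonempty {h : Set M | IsProperFilter h} (by
    intro c hc hchain hcne
    refine ⟨⋃₀ c, ⟨?_, ?_, ?_⟩, fun s hs => Set.subset_sUnion_of_mem hs⟩
    · rintro a b ⟨s, hs, ha⟩ hab
      exact ⟨s, hs, (hc hs).up a b ha hab⟩
    · rintro a b ⟨s, hs, ha⟩ ⟨t, ht, hb⟩
      rcases hchain.total hs ht with hst | hst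
      · exact ⟨t, ht, (hc ht).meet_mem a b (hst ha) hb⟩
      · exact ⟨s, hs, (hc hs).meet_mem a b ha (hst hb)⟩
    · rintro ⟨s, hs, h0⟩
      exact (hc hs).zero h0) g hg
  refine ⟨h, hgh, hmax.prop, ?_⟩
  intro a ha
  by_contra! hcon
  have hf := hmax.prop
  obtain ⟨e, he⟩ := hne
  have hk : IsProperFilter {x | ∃ e ∈ h, meet e a ≤ x} := by
    refine ⟨?_, ?_, ?_⟩
    · rintro x y ⟨e, he, hx⟩ hxy
      exact ⟨e, he, hx.trans hxy⟩
    · rintro x y ⟨e, he, hx⟩ ⟨e', he', hy⟩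
      refine ⟨meet e e', hf.meet_mem _ _ he he', le_meet (le_trans ?_ hx) (le_trans ?_ hy)⟩
      · exact le_meet ((meet_le_left _ _).trans (meet_le_left _ _)) (meet_le_right _ _)
      · exact le_meet ((meet_le_left _ _).trans (meet_le_right _ _)) (meet_le_right _ _)
    · rintro ⟨e, he, h0⟩
      exact hcon e he (eq_zero_of_le_zero h0)
  exact ha (hmax.le_of_ge hk (fun x hx => ⟨x, hx, meet_le_left _ _⟩)
    ⟨e, hgh he, meet_le_right _ _⟩)

namespace IsUltra

variable {g : Set M}

theorem add_notMem (hg : IsUltra g) {a b : M} (ha : a ∉ g) (hb : b ∉ g) : a + b ∉ g := by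
  obtain ⟨e, he, hea⟩ := hg.ultra a ha
  obtain ⟨f, hf, hfb⟩ := hg.ultra b hb
  intro hab
  have h := hg.meet_mem _ _ (hg.meet_mem _ _ he hf) hab
  rw [meet_add_eq_zero (meet_eq_zero_mono hea (meet_le_left e f) le_rfl)
    (meet_eq_zero_mono hfb (meet_le_right e f) le_rfl)] at h
  exact hg.zero h

theorem notMem_of_le (hg : IsUltra g) {a b : M} (hab : a ≤ b) (hb : b ∉ g) : a ∉ g :=
  fun ha => hb (hg.up a b ha hab)

theorem sub_notMem_total (hg : IsUltra g) (a b : M) : a - b ∉ g ∨ b - a ∉ g := by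
  by_contra! h
  have := hg.meet_mem _ _ h.1 h.2
  rw [meet_sub_sub] at this
  exact hg.zero this

/-- Equality modulo the complementary ideal of a maximal filter. -/
def setoid (hg : IsUltra g) : Setoid M where
  r a b := a - b ∉ g ∧ b - a ∉ g
  iseqv := by
    refine ⟨fun a => ?_, fun h => h.symm, ?_⟩
    · rw [sub_self']; exact ⟨hg.zero, hg.zero⟩
    · rintro a b c ⟨h1, h2⟩ ⟨h3, h4⟩
      exact ⟨hg.notMem_of_le tsub_le_tsub_add_tsub (hg.add_notMem h1 h3),
        hg.notMem_of_le tsub_le_tsub_add_tsub (hg.add_notMem h4 h2)⟩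

theorem sub_congr (hg : IsUltra g) {a b c d : M} (hab : hg.setoid.r a b) (hcd : hg.setoid.r c d) :
    hg.setoid.r (a - c) (b - d) := by
  have h1 : hg.setoid.r (a - c) (b - c) :=
    ⟨hg.notMem_of_le (sub_sub_sub_le_right _ _ _) hab.1,
      hg.notMem_of_le (sub_sub_sub_le_right _ _ _) hab.2⟩
  have h2 : hg.setoid.r (b - c) (b - d) :=
    ⟨hg.notMem_of_le (sub_sub_sub_le _ _ _) hcd.2,
      hg.notMem_of_le (sub_sub_sub_le _ _ _) hcd.1⟩
  exact hg.setoid.iseqv.trans h1 h2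

/-- The quotient by the complementary ideal of a maximal filter. -/
def quotient (hg : IsUltra g) : Type _ := Quotient hg.setoid

instance (hg : IsUltra g) : BoundedBCK hg.quotient where
  sub := Quotient.map₂ (· - ·) fun _ _ hab _ _ hcd => hg.sub_congr hab hcd
  zero := Quotient.mk _ 0
  one := Quotient.mk _ 1
  sub_right_comm' := by
    rintro ⟨a⟩ ⟨b⟩ ⟨c⟩
    exact congrArg (Quotient.mk hg.setoid) (sub_right_comm' a b c)
  sub_sub_comm' := by
    rintro ⟨a⟩ ⟨b⟩
    exact congrArg (Quotient.mk hg.setoid) (sub_sub_comm' a b)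
  sub_self' := by
    rintro ⟨a⟩
    exact congrArg (Quotient.mk hg.setoid) (sub_self' a)
  sub_zero' := by
    rintro ⟨a⟩
    exact congrArg (Quotient.mk hg.setoid) (sub_zero' a)
  zero_sub' := by
    rintro ⟨a⟩
    exact congrArg (Quotient.mk hg.setoid) (zero_sub' a)
  sub_one' := by
    rintro ⟨a⟩
    exact congrArg (Quotient.mk hg.setoid) (sub_one' a)

/-- The quotient map. -/
def toQuot (hg : IsUltra g) (a : M) : hg.quotient := Quotient.mk _ a

theorem toQuot_sub (hg : IsUltra g) (a b : M) : hg.toQuot (a - b) = hg.toQuot a - hg.toQuot b := rfl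

theorem toQuot_one (hg : IsUltra g) : hg.toQuot 1 = 1 := rfl

theorem toQuot_add (hg : IsUltra g) (a b : M) : hg.toQuot (a + b) = hg.toQuot a + hg.toQuot b := rfl

theorem toQuot_eq_zero (hg : IsUltra g) {a : M} : hg.toQuot a = 0 ↔ a ∉ g := by
  constructor
  · intro h
    have : hg.setoid.r a 0 := Quotient.exact h
    have h1 := this.1
    rwa [sub_zero'] at h1
  · intro h
    refine Quotient.sound (show hg.setoid.r a 0 from ?_)
    refine ⟨?_, ?_⟩
    · rwa [sub_zero']
    · rw [zero_sub']; exact hg.zero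

theorem toQuot_le (hg : IsUltra g) {a b : M} : hg.toQuot a ≤ hg.toQuot b ↔ a - b ∉ g := by
  rw [le_iff, ← toQuot_sub, toQuot_eq_zero]

theorem toQuot_mono (hg : IsUltra g) {a b : M} (h : a ≤ b) : hg.toQuot a ≤ hg.toQuot b := by
  rw [toQuot_le, le_iff.1 h]; exact hg.zero

theorem toQuot_total (hg : IsUltra g) (a b : hg.quotient) : a ≤ b ∨ b ≤ a := by
  obtain ⟨a⟩ := a
  obtain ⟨b⟩ := b
  exact (hg.sub_notMem_total a b).imp hg.toQuot_le.2 hg.toQuot_le.2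

/-- A maximal filter carries a state which factors through the quotient. -/
theorem exists_state (hg : IsUltra g) (hne : g.Nonempty) :
    ∃ q : hg.quotient → ℝ, IsState q ∧ IsState (q ∘ hg.toQuot) := by
  have h1 : (1 : M) ∈ g := hg.up _ _ hne.some_mem (BoundedBCK.le_one _)
  obtain ⟨q, hq⟩ := exists_isState_of_total hg.toQuot_total
    (show (1 : hg.quotient) ≠ 0 from fun h => hg.toQuot_eq_zero.1 h h1)
  refine ⟨q, hq, fun a => hq.nonneg _, hq.one, fun a b hab => ?_⟩
  exact hq.add (hg.toQuot a) (hg.toQuot b) (hg.toQuot_mono hab)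

end IsUltra

end Ultrafilter

theorem IsState.nsmul_eq {p : M → ℝ} (hp : IsState p) {j : ℕ} {d : M}
    (h : ∀ i < j, i • d ≤ 1 - d) : p (j • d) = j * p d := by
  induction j with
  | zero => simp [hp.zero]
  | succ n ih =>
    rw [succ_nsmul, hp.add _ _ (h n n.lt_succ_self), ih fun i hi => h i (hi.trans n.lt_succ_self)]
    push_cast; ring

/-- In a chain a multiple below one is a sum without overflow. -/
theorem nsmul_le_compl_of_ne_one (htot : ∀ a b : M, a ≤ b ∨ b ≤ a) {j : ℕ} {d : M}
    (h : j • d ≠ 1) : ∀ i < j, i • d ≤ 1 - d := by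
  intro i hi
  refine (htot _ _).resolve_right fun h1 => h ?_
  refine le_antisymm (le_one _) ?_
  calc (1 : M) = d + (1 - d) := (add_sub_cancel_of_le' (le_one d)).symm
    _ ≤ d + i • d := by gcongr
    _ = (i + 1) • d := by rw [succ_nsmul, add_comm]
    _ ≤ j • d := nsmul_le_nsmul_left (zero_le' d) hi

/-- Suprema of increasing sequences exist. -/
def SigmaComplete (M : Type*) [BoundedBCK M] : Prop :=
  ∀ f : ℕ → M, Monotone f → ∃ s, IsLUB (Set.range f) s

theorem SigmaComplete.exists_overflow (hM : SigmaComplete M) {c : M} (hc : c ≠ 0) :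
    ∃ m : ℕ, ¬ c ≤ 1 - m • c := by
  by_contra! h
  obtain ⟨s, hs⟩ := hM (fun m => m • c) (fun i j hij => nsmul_le_nsmul_left (zero_le' c) hij)
  have hcs : c ≤ s := by simpa using hs.1 ⟨1, rfl⟩
  have : s ≤ s - c := by
    refine hs.2 ?_
    rintro _ ⟨m, rfl⟩
    have h1 : (m + 1) • c ≤ s := hs.1 ⟨m + 1, rfl⟩
    rw [succ_nsmul, add_comm] at h1
    change m • c ≤ s - c
    rw [← add_sub_cancel_left_of_le (le_compl_comm (h m))]
    exact sub_le_sub_right' h1 c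
  apply hc
  rw [← sub_sub_of_le hcs]
  exact le_iff.1 this

theorem exists_meet_compl_nsmul_ne_zero {d : ℕ → M} (hd : Antitone d)
    (h0 : IsGLB (Set.range d) 0) (j : ℕ) {e : M} (he : e ≠ 0) :
    ∃ n, meet e (1 - j • d n) ≠ 0 := by
  have hj : ∀ z, (∀ n, z ≤ j • d n) → z = 0 := by
    induction j with
    | zero => intro z hz; exact eq_zero_of_le_zero (by simpa using hz 0)
    | succ j ih =>
      intro z hz
      refine eq_zero_of_le_zero (h0.2 ?_)
      rintro _ ⟨m, rfl⟩
      refine le_iff.2 (ih _ fun n => ?_)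
      rcases le_total m n with hmn | hmn
      · rw [tsub_le_iff_right]
        refine (hz n).trans ?_
        rw [succ_nsmul]
        gcongr
        exact hd hmn
      · rw [tsub_le_iff_right]
        refine (hz m).trans ?_
        rw [succ_nsmul]
        gcongr
        exact hd hmn
  by_contra! h
  refine he (hj e fun n => ?_)
  have h1 := sub_eq_of_meet_eq_zero (h n)
  rw [← h1]
  exact (sub_le_sub_right' (le_one e) _).trans (compl_compl _).le

theorem exists_state_of_not_le (hM : SigmaComplete M) {ι : Type*} [Countable ι] (d : ι → ℕ → M)
    (hd : ∀ i, Antitone (d i)) (h0 : ∀ i, IsGLB (Set.range (d i)) 0) {a b : M} (hab : ¬ a ≤ b) :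
    ∃ p : M → ℝ, IsState p ∧ p b < p a ∧
      ∀ i, Filter.Tendsto (fun n => p (d i n)) Filter.atTop (nhds 0) := by
  set c := a - b with hc
  have hc0 : c ≠ 0 := hab
  obtain ⟨m, hm⟩ := hM.exists_overflow hc0
  set e₀ : M := c - (1 - m • c) with he₀
  have he₀0 : e₀ ≠ 0 := hm
  have he₀c : meet e₀ (1 - (m + 1) • c) = 0 := by
    rw [succ_nsmul, compl_add]; exact meet_sub_sub _ _
  have hrec : ∀ (x : {e : M // e ≠ 0}) (k : Option ι × ℕ), ∃ y : {e : M // e ≠ 0}, y.1 ≤ x.1 ∧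
      ∀ i, k.1 = some i → ∃ n, y.1 ≤ 1 - k.2 • d i n := by
    rintro ⟨x, hx⟩ ⟨i, j⟩
    rcases i with _ | i
    · exact ⟨⟨x, hx⟩, le_rfl, by simp⟩
    · obtain ⟨n, hn⟩ := exists_meet_compl_nsmul_ne_zero (hd i) (h0 i) j hx
      refine ⟨⟨_, hn⟩, meet_le_left _ _, ?_⟩
      rintro i' h
      obtain rfl := Option.some.inj h
      exact ⟨n, meet_le_right _ _⟩
  choose next hnext hforce using hrec
  obtain ⟨enum, henum⟩ := exists_surjective_nat (Option ι × ℕ)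
  let e : ℕ → {e : M // e ≠ 0} := fun n => Nat.rec ⟨e₀, he₀0⟩ (fun n x => next x (enum n)) n
  have he : Antitone fun n => (e n).1 := antitone_nat_of_succ_le fun n => hnext (e n) (enum n)
  have hfil : IsProperFilter {x : M | ∃ n, (e n).1 ≤ x} := by
    refine ⟨?_, ?_, ?_⟩
    · rintro x y ⟨n, hn⟩ hxy
      exact ⟨n, hn.trans hxy⟩
    · rintro x y ⟨n, hn⟩ ⟨k, hk⟩
      exact ⟨max n k, le_meet ((he (le_max_left n k)).trans hn) ((he (le_max_right n k)).trans hk)⟩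
    · rintro ⟨n, hn⟩
      exact (e n).2 (eq_zero_of_le_zero hn)
  obtain ⟨g, hsub, hg⟩ := hfil.exists_ultra ⟨e₀, 0, le_rfl⟩
  have heg : ∀ n, (e n).1 ∈ g := fun n => hsub ⟨n, le_rfl⟩
  obtain ⟨q, hq, hp⟩ := hg.exists_state ⟨e₀, heg 0⟩
  refine ⟨q ∘ hg.toQuot, hp, ?_, ?_⟩
  · have hcg : c ∈ g := hg.up _ _ (heg 0) (sub_le_self' c _)
    have hba : hg.toQuot b ≤ hg.toQuot a :=
      (hg.toQuot_total _ _).resolve_left fun h => hg.toQuot_le.1 h hcg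
    have h1 : q (hg.toQuot c) = q (hg.toQuot a) - q (hg.toQuot b) := by
      rw [hc, hg.toQuot_sub, hq.sub hba]
    have h2 : hg.toQuot ((m + 1) • c) = 1 := by
      refine le_antisymm (le_one _) (hg.toQuot_le.2 fun h => ?_)
      have := hg.meet_mem _ _ (heg 0) h
      rw [show (e 0).1 = e₀ from rfl, he₀c] at this
      exact hg.zero this
    have h3 := hp.nsmul_le (m + 1) c
    simp only [Function.comp_apply, h2, hq.one] at h3
    have h4 : 0 < q (hg.toQuot c) := by
      by_contra! h5
      have : ((m + 1 : ℕ) : ℝ) * q (hg.toQuot c) ≤ 0 := mul_nonpos_of_nonneg_of_nonpos (by positivity) h5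
      linarith
    simp only [Function.comp_apply]
    linarith
  · intro i
    have hmk : ∀ (j : ℕ) (x : M), hg.toQuot (j • x) = j • hg.toQuot x := by
      intro j x
      induction j with
      | zero => rw [zero_nsmul, zero_nsmul]; rfl
      | succ j ih => rw [succ_nsmul, succ_nsmul, hg.toQuot_add, ih]
    rw [Metric.tendsto_atTop]
    intro ε hε
    obtain ⟨j, hj⟩ := exists_nat_gt (1 / ε)
    obtain ⟨k, hk⟩ := henum (some i, j)
    obtain ⟨n, hn⟩ := hforce (e k) (enum k) i (by rw [hk])
    rw [show (enum k).2 = j by rw [hk]] at hn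
    have hmem : 1 - j • d i n ∈ g := hg.up _ _ (heg (k + 1)) hn
    have hne : j • hg.toQuot (d i n) ≠ 1 := by
      intro h
      rw [← hmk] at h
      exact hg.toQuot_le.1 (show hg.toQuot 1 ≤ hg.toQuot (j • d i n) from h.ge) hmem
    have h1 := hq.nsmul_eq (nsmul_le_compl_of_ne_one hg.toQuot_total hne)
    have h2 := hq.le_one (j • hg.toQuot (d i n))
    refine ⟨n, fun n' hn' => ?_⟩
    have h3 := hp.mono (hd i hn')
    have h4 := hp.nonneg (d i n')
    rw [Real.dist_eq, sub_zero, abs_of_nonneg h4]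
    refine lt_of_le_of_lt h3 ?_
    simp only [Function.comp_apply]
    have hjpos : (0 : ℝ) < j := lt_trans (by positivity) hj
    rw [div_lt_iff₀ hε] at hj
    have h5 : (j : ℝ) * q (hg.toQuot (d i n)) < j * ε := by linarith
    exact lt_of_mul_lt_mul_left h5 hjpos.le

section Generic

/-- Decreasing sequences with infimum zero. -/
def NullSeq (M : Type*) [BoundedBCK M] : Type _ :=
  {d : ℕ → M // Antitone d ∧ IsGLB (Set.range d) 0}

/-- The type of states. -/
abbrev State (M : Type*) [BoundedBCK M] : Type _ := {p : M → ℝ // IsState p}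

/-- A property holds for generic states if it holds for all the states which are continuous along
suitable countably many null sequences. -/
def generic (M : Type*) [BoundedBCK M] : Filter (State M) :=
  Filter.countableGenerate (Set.range fun d : NullSeq M =>
    {p : State M | Filter.Tendsto (fun n => p.1 (d.1 n)) Filter.atTop (nhds 0)})

instance : CountableInterFilter (generic M) :=
  inferInstanceAs (CountableInterFilter (Filter.countableGenerate _))

theorem le_of_eventually_generic (hM : SigmaComplete M) {a b : M}
    (h : ∀ᶠ p in generic M, p.1 a ≤ p.1 b) : a ≤ b := by
  obtain ⟨S, hS, hSc, hSs⟩ := Filter.mem_countableGenerate_iff.1 h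
  by_contra hab
  have : Countable S := hSc
  choose d hd using fun s : S => hS s.2
  obtain ⟨p, hp, hlt, hlim⟩ := exists_state_of_not_le hM (fun s => (d s).1)
    (fun s => (d s).2.1) (fun s => (d s).2.2) hab
  have hmem : (⟨p, hp⟩ : State M) ∈ ⋂₀ S := by
    intro s hs
    have h1 := hd ⟨s, hs⟩
    change _ = s at h1
    rw [← h1]
    exact hlim ⟨s, hs⟩
  have h2 : p a ≤ p b := hSs hmem
  linarith

theorem eventually_tendsto_of_isLUB {f : ℕ → M} (hf : Monotone f) {s : M}
    (hs : IsLUB (Set.range f) s) :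
    ∀ᶠ p in generic M, Filter.Tendsto (fun n => p.1 (f n)) Filter.atTop (nhds (p.1 s)) := by
  have hle : ∀ n, f n ≤ s := fun n => hs.1 ⟨n, rfl⟩
  let d : NullSeq M := ⟨fun n => s - f n, fun i j hij => sub_le_sub_left' (hf hij) s, by
    refine ⟨by rintro _ ⟨n, rfl⟩; exact zero_le' _, fun z hz => ?_⟩
    have hz' : ∀ n, z ≤ s - f n := fun n => hz ⟨n, rfl⟩
    have h1 : s ≤ s - z := hs.2 (by
      rintro _ ⟨n, rfl⟩
      rw [← sub_sub_of_le (hle n)]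
      exact sub_le_sub_left' (hz' n) s)
    rw [← sub_sub_of_le ((hz' 0).trans (sub_le_self' s _))]
    exact (le_iff.1 h1).le⟩
  have hd : ∀ᶠ p in generic M, Filter.Tendsto (fun n => p.1 (d.1 n)) Filter.atTop (nhds 0) :=
    Filter.CountableGenerateSets.basic ⟨d, rfl⟩
  filter_upwards [hd] with p hp
  have h2 : ∀ n, p.1 (d.1 n) = p.1 s - p.1 (f n) := fun n => p.2.sub (hle n)
  simp only [h2] at hp
  simpa using (tendsto_const_nhds (x := p.1 s)).sub hp

theorem eventually_tendsto_of_isGLB {f : ℕ → M} (hf : Antitone f)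
    (hs : IsGLB (Set.range f) 0) :
    ∀ᶠ p in generic M, Filter.Tendsto (fun n => p.1 (f n)) Filter.atTop (nhds 0) :=
  Filter.CountableGenerateSets.basic ⟨⟨f, hf, hs⟩, rfl⟩

end Generic

section Extension

open MeasureTheory Filter Topology

theorem leftLim_stieltjesFunction_eq {G : ℝ → ℝ} (hG : Monotone G) {t : ℝ}
    (h : Tendsto (fun n : ℕ => G (t - 1 / (n + 1))) atTop (𝓝 (G t))) :
    Function.leftLim hG.stieltjesFunction t = G t := by
  have hpos : ∀ n : ℕ, t - 1 / ((n : ℝ) + 1) < t := fun n => by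
    have : (0 : ℝ) < 1 / ((n : ℝ) + 1) := by positivity
    linarith
  refine le_antisymm ?_ ?_
  · refine le_of_tendsto (hG.stieltjesFunction.mono.tendsto_leftLim t) ?_
    filter_upwards [self_mem_nhdsWithin] with y hy
    rw [hG.stieltjesFunction_eq]
    exact hG.rightLim_le hy
  · refine le_of_tendsto' h fun n => ?_
    calc G (t - 1 / (n + 1)) ≤ hG.stieltjesFunction (t - 1 / (n + 1)) := by
          rw [hG.stieltjesFunction_eq]; exact hG.le_rightLim le_rfl
      _ ≤ _ := hG.stieltjesFunction.mono.le_leftLim (hpos n)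

theorem tendsto_stieltjesFunction_atTop {G : ℝ → ℝ} (hG : Monotone G) {l : ℝ} (hle : ∀ x, G x ≤ l)
    (h : Tendsto (fun n : ℕ => G n) atTop (𝓝 l)) :
    Tendsto hG.stieltjesFunction atTop (𝓝 l) := by
  refine tendsto_atTop_isLUB hG.stieltjesFunction.mono ⟨?_, fun b hb => ?_⟩
  · rintro _ ⟨x, rfl⟩
    rw [hG.stieltjesFunction_eq]
    exact (hG.rightLim_le (lt_add_one x)).trans (hle _)
  · refine le_of_tendsto' h fun n => le_trans ?_ (hb ⟨n, rfl⟩)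
    rw [hG.stieltjesFunction_eq]; exact hG.le_rightLim le_rfl

theorem tendsto_stieltjesFunction_atBot {G : ℝ → ℝ} (hG : Monotone G) {l : ℝ} (hle : ∀ x, l ≤ G x)
    (h : Tendsto (fun n : ℕ => G (-n)) atTop (𝓝 l)) :
    Tendsto hG.stieltjesFunction atBot (𝓝 l) := by
  refine tendsto_atBot_isGLB hG.stieltjesFunction.mono ⟨?_, fun b hb => ?_⟩
  · rintro _ ⟨x, rfl⟩
    rw [hG.stieltjesFunction_eq]
    exact (hle x).trans (hG.le_rightLim le_rfl)
  · refine ge_of_tendsto' ((tendsto_add_atTop_iff_nat 1).2 h) fun n =>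
      le_trans (hb ⟨-((n : ℝ) + 1) - 1, rfl⟩) ?_
    rw [hG.stieltjesFunction_eq]
    exact hG.rightLim_le (by push_cast; linarith)

/-- Spectral resolutions in a bounded commutative BCK-algebra. -/
structure IsResolution (F : ℝ → M) : Prop where
  mono : Monotone F
  bot : IsGLB (Set.range F) 0
  top : IsLUB (Set.range F) 1
  left : ∀ s, IsLUB (F '' Set.Iio s) (F s)

variable {F : ℝ → M}

theorem IsResolution.monotone_state (hF : IsResolution F) (p : State M) :
    Monotone fun t => p.1 (F t) :=
  fun _ _ h => p.2.mono (hF.mono h)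

/-- The distribution of a state along a resolution. -/
noncomputable def distribution (hF : IsResolution F) (p : State M) : Measure ℝ :=
  (hF.monotone_state p).stieltjesFunction.measure

theorem IsResolution.eventually_tendsto_atBot (hF : IsResolution F) : ∀ᶠ p in generic M,
    Tendsto (fun n : ℕ => p.1 (F (-n))) atTop (𝓝 0) := by
  refine eventually_tendsto_of_isGLB (f := fun n : ℕ => F (-n))
    (fun i j hij => hF.mono (by simpa using hij)) ⟨?_, fun b hb => hF.bot.2 ?_⟩
  · rintro _ ⟨n, rfl⟩; exact zero_le' _
  · rintro _ ⟨t, rfl⟩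
    obtain ⟨n, hn⟩ := exists_nat_gt (-t)
    exact (hb ⟨n, rfl⟩).trans (hF.mono (by linarith))

theorem IsResolution.eventually_tendsto_atTop (hF : IsResolution F) : ∀ᶠ p in generic M,
    Tendsto (fun n : ℕ => p.1 (F n)) atTop (𝓝 1) := by
  have := eventually_tendsto_of_isLUB (f := fun n : ℕ => F n) (s := 1)
    (fun i j hij => hF.mono (by simpa using hij)) (by
      refine ⟨?_, fun b hb => hF.top.2 ?_⟩
      · rintro _ ⟨n, rfl⟩; exact le_one _
      · rintro _ ⟨t, rfl⟩
        obtain ⟨n, hn⟩ := exists_nat_gt t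
        exact (hF.mono hn.le).trans (hb ⟨n, rfl⟩))
  filter_upwards [this] with p hp
  rwa [p.2.one] at hp

theorem IsResolution.eventually_tendsto_left (hF : IsResolution F) (t : ℝ) : ∀ᶠ p in generic M,
    Tendsto (fun n : ℕ => p.1 (F (t - 1 / (n + 1)))) atTop (𝓝 (p.1 (F t))) := by
  refine eventually_tendsto_of_isLUB (f := fun n : ℕ => F (t - 1 / (n + 1)))
    (fun i j hij => hF.mono ?_) ⟨?_, fun b hb => (hF.left t).2 ?_⟩
  · have := Nat.one_div_le_one_div (α := ℝ) hij
    linarith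
  · rintro _ ⟨n, rfl⟩
    exact hF.mono (by have : (0 : ℝ) < 1 / ((n : ℝ) + 1) := by positivity
                      linarith)
  · rintro _ ⟨s, hs, rfl⟩
    obtain ⟨n, hn⟩ := exists_nat_one_div_lt (sub_pos.2 (Set.mem_Iio.1 hs))
    exact (hF.mono (by linarith)).trans (hb ⟨n, rfl⟩)

theorem eventually_isProbabilityMeasure (hF : IsResolution F) :
    ∀ᶠ p in generic M, IsProbabilityMeasure (distribution hF p) := by
  filter_upwards [hF.eventually_tendsto_atBot, hF.eventually_tendsto_atTop] with p h0 h1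
  constructor
  rw [distribution, StieltjesFunction.measure_univ _
    (tendsto_stieltjesFunction_atBot _ (fun x => p.2.nonneg _) h0)
    (tendsto_stieltjesFunction_atTop _ (fun x => p.2.le_one _) h1)]
  simp

/-- The element `a` represents the set `A`. -/
def Represents (hF : IsResolution F) (A : Set ℝ) (a : M) : Prop :=
  ∀ᶠ p in generic M, distribution hF p A = ENNReal.ofReal (p.1 a)

theorem represents_Iio (hF : IsResolution F) (t : ℝ) : Represents hF (Set.Iio t) (F t) := by
  filter_upwards [hF.eventually_tendsto_atBot, hF.eventually_tendsto_left t] with p h0 h1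
  rw [distribution, StieltjesFunction.measure_Iio _
    (tendsto_stieltjesFunction_atBot _ (fun x => p.2.nonneg _) h0),
    leftLim_stieltjesFunction_eq _ h1, sub_zero]

namespace Represents

variable {hF : IsResolution F} {A B : Set ℝ} {a b : M}

theorem mono (hM : SigmaComplete M) (ha : Represents hF A a) (hb : Represents hF B b)
    (hAB : A ⊆ B) : a ≤ b := by
  refine le_of_eventually_generic hM ?_
  filter_upwards [ha, hb] with p hpa hpb
  have := measure_mono (μ := distribution hF p) hAB
  rwa [hpa, hpb, ENNReal.ofReal_le_ofReal_iff (p.2.nonneg _)] at this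

theorem unique (hM : SigmaComplete M) (ha : Represents hF A a) (hb : Represents hF A b) : a = b :=
  le_antisymm (ha.mono hM hb subset_rfl) (hb.mono hM ha subset_rfl)

theorem empty : Represents hF ∅ 0 := by
  refine Eventually.of_forall fun p => ?_
  simp [p.2.zero]

theorem univ : Represents hF Set.univ 1 := by
  filter_upwards [eventually_isProbabilityMeasure hF] with p hp
  simp [p.2.one]

theorem compl (hA : MeasurableSet A) (ha : Represents hF A a) : Represents hF Aᶜ (1 - a) := by
  filter_upwards [eventually_isProbabilityMeasure hF, ha] with p hp hpa
  rw [prob_compl_eq_one_sub hA, hpa, p.2.sub (le_one a), p.2.one, ENNReal.ofReal_sub _ (p.2.nonneg a),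
    ENNReal.ofReal_one]

theorem disjoint (hM : SigmaComplete M) (hB : MeasurableSet B) (ha : Represents hF A a)
    (hb : Represents hF B b) (hAB : Disjoint A B) : a ≤ 1 - b :=
  ha.mono hM (hb.compl hB) hAB.subset_compl_right

theorem union (hM : SigmaComplete M) (hB : MeasurableSet B) (ha : Represents hF A a)
    (hb : Represents hF B b) (hAB : Disjoint A B) : Represents hF (A ∪ B) (a + b) := by
  have h := disjoint hM hB ha hb hAB
  filter_upwards [ha, hb] with p hpa hpb
  rw [measure_union hAB hB, hpa, hpb, p.2.add _ _ h, ENNReal.ofReal_add (p.2.nonneg a) (p.2.nonneg b)]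

theorem iUnion {A : ℕ → Set ℝ} {a : ℕ → M} {s : M} (hA : Monotone A) (hmono : Monotone a)
    (ha : ∀ n, Represents hF (A n) (a n)) (hs : IsLUB (Set.range a) s) :
    Represents hF (⋃ n, A n) s := by
  filter_upwards [eventually_countable_forall.2 ha, eventually_tendsto_of_isLUB hmono hs]
    with p hpa hps
  have h1 := tendsto_measure_iUnion_atTop (μ := distribution hF p) hA
  have h2 := ENNReal.tendsto_ofReal hps
  refine tendsto_nhds_unique h1 (h2.congr fun n => ?_)
  simp [hpa]

theorem exists_of_measurableSet (hM : SigmaComplete M) (hF : IsResolution F) {A : Set ℝ}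
    (hA : MeasurableSet A) : ∃ a, Represents hF A a := by
  induction A, hA using MeasurableSpace.induction_on_inter
    (borel_eq_generateFrom_Iio ℝ ▸ BorelSpace.measurable_eq) isPiSystem_Iio with
  | empty => exact ⟨0, empty⟩
  | basic t ht =>
    obtain ⟨t, rfl⟩ := ht
    exact ⟨F t, represents_Iio hF t⟩
  | compl t ht ih =>
    obtain ⟨a, ha⟩ := ih
    exact ⟨1 - a, ha.compl ht⟩
  | iUnion f hd hf ih =>
    have hfin : ∀ n, ∃ a, Represents hF (Set.accumulate f n) a := by
      intro n
      induction n with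
      | zero => simpa using ih 0
      | succ n ihn =>
        obtain ⟨a, ha⟩ := ihn
        obtain ⟨b, hb⟩ := ih (n + 1)
        rw [Set.accumulate_succ]
        exact ⟨a + b, ha.union hM (hf _) hb (Set.disjoint_accumulate hd n.lt_succ_self)⟩
    choose a ha using hfin
    have hmono : Monotone a := fun i j hij => (ha i).mono hM (ha j) (Set.monotone_accumulate hij)
    obtain ⟨s, hs⟩ := hM a hmono
    rw [← Set.iUnion_accumulate]
    exact ⟨s, iUnion Set.monotone_accumulate hmono ha hs⟩

end Represents

theorem exists_extension (hM : SigmaComplete M) (hF : IsResolution F) :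
    ∃ x : BorelSet → M, x ⟨Set.univ, MeasurableSet.univ⟩ = 1 ∧
      (∀ A B : BorelSet, Disjoint A.1 B.1 →
        x A ≤ 1 - x B ∧ x ⟨A.1 ∪ B.1, A.2.union B.2⟩ = x A + x B) ∧
      (∀ f : ℕ → BorelSet, (∀ n, (f n).1 ⊆ (f (n + 1)).1) →
        IsLUB (Set.range fun n => x (f n))
          (x ⟨⋃ n, (f n).1, MeasurableSet.iUnion (fun n => (f n).2)⟩)) ∧
      ∀ t, x (bIio t) = F t := by
  choose x hx using fun A : BorelSet => Represents.exists_of_measurableSet hM hF A.2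
  refine ⟨x, (hx _).unique hM Represents.univ, fun A B hAB => ?_, fun f hf => ?_, fun t => ?_⟩
  · exact ⟨(hx A).disjoint hM B.2 (hx B) hAB,
      (hx _).unique hM ((hx A).union hM B.2 (hx B) hAB)⟩
  · have hmonof : Monotone fun n => (f n).1 := monotone_nat_of_le_succ hf
    have hmono : Monotone fun n => x (f n) := fun i j hij => (hx _).mono hM (hx _) (hmonof hij)
    obtain ⟨s, hs⟩ := hM _ hmono
    rwa [(hx _).unique hM (Represents.iUnion hmonof hmono (fun n => hx (f n)) hs)]
  · exact (hx _).unique hM (represents_Iio hF t)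

end Extension

end BoundedBCK

/-- A difference lattice: the difference `a - b` of a bounded lattice ordered effect algebra is
extended to all pairs by `a - b = a - a ⊓ b`. -/
class DifferenceLattice (E : Type*) extends Lattice E, BoundedOrder E, Sub E where
  sub_inf : ∀ a b : E, a - a ⊓ b = a - b
  sub_le : ∀ a b : E, a - b ≤ a
  sub_sub_of_le : ∀ a b : E, b ≤ a → a - (a - b) = b
  sub_sub_sub : ∀ a b c : E, a ≤ b → b ≤ c → (c - a) - (c - b) = b - a
  sub_le_sub_of_le : ∀ a b c : E, a ≤ b → b ≤ c → c - b ≤ c - a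

namespace DifferenceLattice

variable {E : Type*} [DifferenceLattice E] {a b c : E}

theorem sub_anti (h : a ≤ b) (c : E) : c - b ≤ c - a := by
  rw [← sub_inf c b, ← sub_inf c a]
  exact sub_le_sub_of_le _ _ _ (inf_le_inf_left c h) inf_le_left

theorem sub_sub_eq_inf (a b : E) : a - (a - b) = a ⊓ b := by
  rw [← sub_inf a b, sub_sub_of_le _ _ inf_le_left]

theorem sub_le_sub_right (hab : a ≤ b) (hbc : b ≤ c) : b - a ≤ c - a := by
  rw [← sub_sub_sub a b c hab hbc]
  exact sub_le _ _

theorem le_sub_comm (hb : b ≤ c) (h : a ≤ c - b) : b ≤ c - a := by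
  rw [← sub_sub_of_le c b hb]
  exact sub_anti h c

theorem compl_compl (a : E) : ⊤ - (⊤ - a) = a := sub_sub_of_le _ _ le_top

theorem le_compl_comm (h : a ≤ ⊤ - b) : b ≤ ⊤ - a := le_sub_comm le_top h

theorem sub_bot (a : E) : a - ⊥ = a := by
  refine le_antisymm (sub_le _ _) ?_
  have h1 : a - (a - a) = a := sub_sub_of_le a a le_rfl
  conv_lhs => rw [← h1]
  exact sub_anti bot_le a

theorem sub_self (a : E) : a - a = ⊥ := by
  conv_lhs => rw [← sub_bot a]
  rw [sub_bot a]
  have h := sub_sub_of_le a ⊥ bot_le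
  rwa [sub_bot] at h

theorem sub_eq_bot_iff : a - b = ⊥ ↔ a ≤ b := by
  constructor
  · intro h
    have h1 := sub_sub_eq_inf a b
    rw [h, sub_bot] at h1
    exact inf_eq_left.1 h1.symm
  · intro h
    rw [← sub_inf, inf_eq_left.2 h, sub_self]

theorem sub_sup (ha : a ≤ c) (hb : b ≤ c) : c - (a ⊔ b) = (c - a) ⊓ (c - b) := by
  refine le_antisymm (le_inf (sub_anti le_sup_left c) (sub_anti le_sup_right c)) ?_
  exact le_sub_comm (inf_le_left.trans (sub_le c a))
    (sup_le (le_sub_comm ha inf_le_left) (le_sub_comm hb inf_le_right))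

theorem compl_sup (a b : E) : ⊤ - (a ⊔ b) = (⊤ - a) ⊓ (⊤ - b) := sub_sup le_top le_top

theorem inf_eq_compl_sup (a b : E) : a ⊓ b = ⊤ - ((⊤ - a) ⊔ (⊤ - b)) := by
  rw [compl_sup, compl_compl, compl_compl]

/-- Compatibility of two elements. -/
def Compat (a b : E) : Prop := a - b ≤ ⊤ - b

theorem Compat.of_le_inf (hca : c ≤ a) (hcb : c ≤ b) (h : a - c ≤ ⊤ - b) : Compat a b := by
  rw [Compat, ← sub_inf]
  exact (sub_anti (le_inf hca hcb) a).trans h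

theorem sub_sub_sub_cancel (hab : a ≤ b) (hbc : b ≤ c) : (c - a) - (b - a) = c - b := by
  rw [← sub_sub_sub a b c hab hbc, sub_sub_of_le _ _ (sub_anti hab c)]

theorem compl_sub_sub (h : b ≤ a) : (⊤ - b) - (a - b) = ⊤ - a :=
  sub_sub_sub_cancel h le_top

theorem Compat.symm (h : Compat a b) : Compat b a := by
  have ha : a - (a ⊓ b) ≤ (⊤ - a ⊓ b) - (b - a ⊓ b) := by
    rw [compl_sub_sub inf_le_right, sub_inf]; exact h
  have hb := le_sub_comm (sub_le_sub_right inf_le_right le_top) ha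
  rw [compl_sub_sub inf_le_left, inf_comm, sub_inf] at hb
  exact hb

theorem Compat.of_le (h : a ≤ b) : Compat a b := by
  rw [Compat, sub_eq_bot_iff.2 h]; exact bot_le

theorem Compat.of_ge (h : b ≤ a) : Compat a b := (Compat.of_le h).symm

theorem Compat.compl_right (h : Compat a b) : Compat a (⊤ - b) := by
  refine Compat.of_le_inf (sub_le a b) h ?_
  rw [compl_compl, sub_sub_eq_inf]
  exact inf_le_right

theorem Compat.compl_left (h : Compat a b) : Compat (⊤ - a) b := h.symm.compl_right.symm

theorem Compat.of_isLUB {S : Set E} {s : E} (hs : IsLUB S s) (h : ∀ b ∈ S, Compat a b) :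
    Compat a s :=
  le_compl_comm (hs.2 fun b hb => le_compl_comm ((sub_anti (hs.1 hb) a).trans (h b hb)))

theorem Compat.sup_right (hb : Compat a b) (hc : Compat a c) : Compat a (b ⊔ c) :=
  Compat.of_isLUB (isLUB_pair (a := b) (b := c)) (by rintro _ (rfl | rfl) <;> assumption)

theorem Compat.inf_right (hb : Compat a b) (hc : Compat a c) : Compat a (b ⊓ c) := by
  rw [inf_eq_compl_sup]
  exact (hb.compl_right.sup_right hc.compl_right).compl_right

theorem Compat.sup_sub_le (h : Compat a b) : (a ⊔ b) - b ≤ a - b := by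
  have hp : a - b ≤ ⊤ - b := h
  set s := ⊤ - ((⊤ - b) - (a - b)) with hs
  have hbs : b ≤ s := le_compl_comm (sub_le _ _)
  have has : a ≤ s := by
    refine le_compl_comm ?_
    have h1 : (⊤ - b) - (a - b) ≤ (⊤ - a ⊓ b) - (a - b) :=
      sub_le_sub_right hp (sub_anti inf_le_right ⊤)
    rwa [← sub_inf a b, compl_sub_sub inf_le_left, sub_inf] at h1
  have hsb : s - b = a - b := by
    rw [← sub_sub_sub b s ⊤ hbs le_top, hs, compl_compl, sub_sub_of_le _ _ hp]
  rw [← hsb]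
  exact sub_le_sub_right le_sup_right (sup_le has hbs)

theorem Compat.sup_sub (h : Compat a b) : (a ⊔ b) - b = a - b := by
  refine le_antisymm h.sup_sub_le ?_
  have h1 := h.compl_left.compl_right.symm.sup_sub_le
  have h2 : (⊤ - b) ⊔ (⊤ - a) = ⊤ - a ⊓ b := by
    rw [inf_eq_compl_sup, compl_compl, sup_comm]
  rw [h2, sub_sub_sub _ _ _ inf_le_left le_top, sub_inf, ← sub_inf (⊤ - b), inf_comm,
    ← compl_sup, sub_sub_sub _ _ _ le_sup_right le_top] at h1
  exact h1

theorem Compat.inf_sub_inf_le (hab : Compat a b) (hac : Compat a c) (hbc : b ≤ c) :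
    a ⊓ c - a ⊓ b ≤ c - b := by
  have hz : a ⊓ b ≤ a ⊓ c := inf_le_inf_left a hbc
  have h1 : b - a ⊓ b ≤ c - a ⊓ c := by
    rw [inf_comm, sub_inf, inf_comm, sub_inf, ← hab.symm.sup_sub, ← hac.symm.sup_sub]
    exact sub_le_sub_right le_sup_right (sup_le_sup_right hbc a)
  rw [← sub_sub_sub_cancel hz inf_le_right] at h1
  rw [← sub_sub_sub_cancel (inf_le_right : a ⊓ b ≤ b) hbc]
  exact le_sub_comm (sub_le_sub_right hz inf_le_right) h1

theorem Compat.sub_right (hb : Compat a b) (hc : Compat a c) : Compat a (c - b) := by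
  rw [← sub_inf]
  have hcb := hc.inf_right hb
  have hle : c ⊓ b ≤ c := inf_le_left
  generalize c ⊓ b = b at hcb hle
  have hw := hcb.inf_sub_inf_le hc hle
  refine (Compat.of_le_inf hw ((sub_le _ _).trans inf_le_left) ?_).symm
  calc c - b - (a ⊓ c - a ⊓ b) ≤ (c - a ⊓ b) - (a ⊓ c - a ⊓ b) :=
        sub_le_sub_right hw (sub_anti inf_le_right c)
    _ = c - a ⊓ c := sub_sub_sub_cancel (inf_le_inf_left a hle) inf_le_right
    _ = c - a := by rw [inf_comm, sub_inf]
    _ ≤ ⊤ - a := hc.symm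

theorem sub_right_comm_of_compat (h : Compat (a - b) (a ⊓ c)) : a - b - c = a - c - b := by
  have h1 : a - b - c = a - b - (a ⊓ c) := by
    rw [← sub_inf, ← sub_inf (a - b) (a ⊓ c), ← inf_assoc, inf_eq_left.2 (sub_le a b)]
  rw [h1, ← h.sup_sub, ← sub_sub_sub _ _ a le_sup_right (sup_le (sub_le a b) inf_le_left),
    sub_sup (sub_le a b) inf_le_left, inf_comm (a - (a - b)), sub_inf, sub_inf a c, sub_sub_eq_inf,
    ← sub_inf (a - c), ← inf_assoc, inf_eq_left.2 (sub_le a c), sub_inf]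

end DifferenceLattice

namespace DifferenceLattice

variable {E : Type*} [DifferenceLattice E] {a b c : E}

/-- Maximal sets of pairwise compatible elements. -/
abbrev IsBlock (B : Set E) : Prop := IsMaxChain Compat B

namespace IsBlock

variable {B : Set E}

theorem compat (hB : IsBlock B) (ha : a ∈ B) (hb : b ∈ B) : Compat a b := by
  by_cases h : a = b
  · exact Compat.of_le h.le
  · exact (hB.1 ha hb h).elim id Compat.symm

theorem mem_of_compat (hB : IsBlock B) (h : ∀ b ∈ B, Compat b a) : a ∈ B := by
  have h1 : IsChain Compat (insert a B) := hB.1.insert fun b hb _ => Or.inr (h b hb)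
  rw [hB.2 h1 (Set.subset_insert a B)]
  exact Set.mem_insert a B

theorem sub_mem (hB : IsBlock B) (ha : a ∈ B) (hb : b ∈ B) : a - b ∈ B :=
  hB.mem_of_compat fun _ hc => (hB.compat hc hb).sub_right (hB.compat hc ha)

theorem inf_mem (hB : IsBlock B) (ha : a ∈ B) (hb : b ∈ B) : a ⊓ b ∈ B :=
  hB.mem_of_compat fun _ hc => (hB.compat hc ha).inf_right (hB.compat hc hb)

theorem bot_mem (hB : IsBlock B) : ⊥ ∈ B :=
  hB.mem_of_compat fun _ _ => Compat.of_ge bot_le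

theorem top_mem (hB : IsBlock B) : ⊤ ∈ B :=
  hB.mem_of_compat fun _ _ => Compat.of_le le_top

theorem isLUB_mem (hB : IsBlock B) {S : Set E} (hS : S ⊆ B) {s : E} (hs : IsLUB S s) : s ∈ B :=
  hB.mem_of_compat fun _ hc => Compat.of_isLUB hs fun _ hb => hB.compat hc (hS hb)

end IsBlock

/-- The elements of a block. -/
def Block (B : Set E) : Type _ := {a : E // a ∈ B}

variable {B : Set E}

/-- A block is a bounded commutative BCK-algebra. -/
@[reducible]
def IsBlock.toBoundedBCK (hB : IsBlock B) : BoundedBCK (Block B) where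
  sub a b := ⟨a.1 - b.1, hB.sub_mem a.2 b.2⟩
  zero := ⟨⊥, hB.bot_mem⟩
  one := ⟨⊤, hB.top_mem⟩
  sub_right_comm' a b c := Subtype.ext <| sub_right_comm_of_compat <|
    hB.compat (hB.sub_mem a.2 b.2) (hB.inf_mem a.2 c.2)
  sub_sub_comm' a b := Subtype.ext <| by
    change a.1 - (a.1 - b.1) = b.1 - (b.1 - a.1)
    rw [sub_sub_eq_inf, sub_sub_eq_inf, inf_comm]
  sub_self' a := Subtype.ext (sub_self a.1)
  sub_zero' a := Subtype.ext (sub_bot a.1)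
  zero_sub' a := Subtype.ext (sub_eq_bot_iff.2 bot_le)
  sub_one' a := Subtype.ext (sub_eq_bot_iff.2 le_top)

/-- Every spectral resolution in a σ-complete difference lattice extends to the Borel sets. -/
theorem exists_extension (hE : ∀ f : ℕ → E, ∃ s, IsLUB (Set.range f) s) {F : ℝ → E}
    (hmono : Monotone F) (hbot : IsGLB (Set.range F) ⊥) (htop : IsLUB (Set.range F) ⊤)
    (hleft : ∀ s, IsLUB (F '' Set.Iio s) (F s)) :
    ∃ x : BorelSet → E, x ⟨Set.univ, MeasurableSet.univ⟩ = ⊤ ∧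
      (∀ A B : BorelSet, Disjoint A.1 B.1 →
        x A ≤ ⊤ - x B ∧ x ⟨A.1 ∪ B.1, A.2.union B.2⟩ = ⊤ - ((⊤ - x A) - x B)) ∧
      (∀ f : ℕ → BorelSet, (∀ n, (f n).1 ⊆ (f (n + 1)).1) →
        IsLUB (Set.range fun n => x (f n))
          (x ⟨⋃ n, (f n).1, MeasurableSet.iUnion (fun n => (f n).2)⟩)) ∧
      ∀ t, x (bIio t) = F t := by
  have hchain : IsChain Compat (Set.range F) := by
    rintro _ ⟨t, rfl⟩ _ ⟨s, rfl⟩ _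
    exact (le_total t s).imp (fun h => Compat.of_le (hmono h)) fun h => Compat.of_le (hmono h)
  obtain ⟨B, hB, hFB⟩ := hchain.exists_maxChain
  let := IsBlock.toBoundedBCK hB
  have le_iff {a b : Block B} : a ≤ b ↔ a.1 ≤ b.1 := by
    rw [← sub_eq_bot_iff]
    exact Subtype.ext_iff
  have isLUB_of {ι : Type} {f : ι → Block B} {s : Block B} {S : Set ι}
      (h : IsLUB ((fun i => (f i).1) '' S) s.1) : IsLUB (f '' S) s := by
    refine ⟨?_, fun b hb => le_iff.2 (h.2 ?_)⟩
    · rintro _ ⟨n, hn, rfl⟩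
      exact le_iff.2 (h.1 ⟨n, hn, rfl⟩)
    · rintro _ ⟨n, hn, rfl⟩
      exact le_iff.1 (hb ⟨n, hn, rfl⟩)
  have exists_isLUB (f : ℕ → Block B) :
      ∃ s : Block B, IsLUB (Set.range fun n => (f n).1) s.1 := by
    obtain ⟨s, hs⟩ := hE fun n => (f n).1
    exact ⟨⟨s, IsBlock.isLUB_mem hB (by rintro _ ⟨n, rfl⟩; exact (f n).2) hs⟩, hs⟩
  have hM : BoundedBCK.SigmaComplete (Block B) := fun f _ => by
    obtain ⟨s, hs⟩ := exists_isLUB f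
    exact ⟨s, Set.image_univ (f := f) ▸ isLUB_of (Set.image_univ ▸ hs)⟩
  let G : ℝ → Block B := fun t => ⟨F t, hFB ⟨t, rfl⟩⟩
  have hG : BoundedBCK.IsResolution G := by
    refine ⟨fun t s h => le_iff.2 (hmono h), ⟨?_, fun b hb => le_iff.2 (hbot.2 ?_)⟩, ?_,
      fun s => isLUB_of (hleft s)⟩
    · rintro _ ⟨t, rfl⟩
      exact le_iff.2 bot_le
    · rintro _ ⟨t, rfl⟩
      exact le_iff.1 (hb ⟨t, rfl⟩)
    · rw [← Set.image_univ]
      exact isLUB_of (by rw [Set.image_univ]; exact htop)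
  obtain ⟨x, h1, hadd, hsup, hF⟩ := BoundedBCK.exists_extension hM hG
  refine ⟨fun A => (x A).1, congrArg Subtype.val h1, fun A C hAC => ?_, fun f hf => ?_,
    fun t => congrArg Subtype.val (hF t)⟩
  · obtain ⟨h2, h3⟩ := hadd A C hAC
    exact ⟨le_iff.1 h2, congrArg Subtype.val h3⟩
  · obtain ⟨s, hs⟩ := exists_isLUB fun n => x (f n)
    have h2 : IsLUB (Set.range fun n => x (f n)) s := by
      rw [← Set.image_univ]
      exact isLUB_of (by rwa [Set.image_univ])
    change IsLUB _ (x _).1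
    rwa [(hsup f hf).unique h2]

end DifferenceLattice

namespace EffectAlgebra

variable {E : Type*} {EA : EffectAlgebra E} {a b c d e f : E}

theorem add_assoc_right (h1 : EA.add a b = some d) (h2 : EA.add d c = some e) :
    ∃ f, EA.add b c = some f ∧ EA.add a f = some e := by
  have h := EA.assoc a b c
  rw [h1, Option.bind_some, h2] at h
  exact Option.bind_eq_some_iff.1 h.symm

theorem add_assoc_left (h1 : EA.add b c = some f) (h2 : EA.add a f = some e) :
    ∃ d, EA.add a b = some d ∧ EA.add d c = some e := by
  have h := EA.assoc a b c
  rw [h1, Option.bind_some, h2] at h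
  exact Option.bind_eq_some_iff.1 h

theorem add_symm (h : EA.add a b = some c) : EA.add b a = some c := by
  rwa [EA.comm]

theorem eq_of_add_eq_one (h1 : EA.add a b = some EA.one) (h2 : EA.add a c = some EA.one) : b = c :=
  (EA.orth a).unique h1 h2

theorem exists_compl (EA : EffectAlgebra E) (a : E) : ∃ b, EA.add a b = some EA.one :=
  (EA.orth a).exists

theorem one_add_zero (EA : EffectAlgebra E) : EA.add EA.one EA.zero = some EA.one := by
  obtain ⟨b, hb⟩ := EA.exists_compl EA.one
  rwa [← EA.pos_one b _ (add_symm hb)]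

theorem add_zero (EA : EffectAlgebra E) (a : E) : EA.add a EA.zero = some a := by
  obtain ⟨b, hb⟩ := EA.exists_compl a
  obtain ⟨f, hf, hbf⟩ := add_assoc_right (add_symm hb) EA.one_add_zero
  rwa [← eq_of_add_eq_one (add_symm hb) hbf] at hf

theorem add_left_cancel (h1 : EA.add a b = some d) (h2 : EA.add a c = some d) : b = c := by
  obtain ⟨e, he⟩ := EA.exists_compl d
  obtain ⟨f, hf, hbf⟩ := add_assoc_right (add_symm h1) he
  obtain ⟨g, hg, hcg⟩ := add_assoc_right (add_symm h2) he
  obtain rfl : f = g := Option.some.inj (hf.symm.trans hg)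
  exact eq_of_add_eq_one (add_symm hbf) (add_symm hcg)

theorem eq_zero_of_add_eq_zero (h : EA.add a b = some EA.zero) : a = EA.zero := by
  obtain ⟨f, hf, -⟩ := add_assoc_right (add_symm h) (add_symm EA.one_add_zero)
  exact EA.pos_one a f hf

theorem le_refl (EA : EffectAlgebra E) (a : E) : EA.le a a := ⟨EA.zero, EA.add_zero a⟩

theorem le_trans (hab : EA.le a b) (hbc : EA.le b c) : EA.le a c := by
  obtain ⟨x, hx⟩ := hab
  obtain ⟨y, hy⟩ := hbc
  obtain ⟨f, -, hf⟩ := add_assoc_right hx hy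
  exact ⟨f, hf⟩

theorem le_antisymm (hab : EA.le a b) (hba : EA.le b a) : a = b := by
  obtain ⟨x, hx⟩ := hab
  obtain ⟨y, hy⟩ := hba
  obtain ⟨f, hf, haf⟩ := add_assoc_right hx hy
  rw [add_left_cancel haf (EA.add_zero a)] at hf
  rw [eq_zero_of_add_eq_zero hf, EA.add_zero] at hx
  exact Option.some.inj hx

theorem zero_le (EA : EffectAlgebra E) (a : E) : EA.le EA.zero a := ⟨a, add_symm (EA.add_zero a)⟩

theorem le_one (EA : EffectAlgebra E) (a : E) : EA.le a EA.one := EA.exists_compl a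

theorem IsSup.unique {S : Set E} (ha : EA.IsSup S a) (hb : EA.IsSup S b) : a = b :=
  le_antisymm (ha.2 _ hb.1) (hb.2 _ ha.1)

/-- The difference `b - a`, which is meaningful only for `a ≤ b`. -/
noncomputable def diff (EA : EffectAlgebra E) (b a : E) : E :=
  haveI : Nonempty E := ⟨a⟩
  Classical.epsilon fun c => EA.add a c = some b

theorem add_diff (h : EA.le a b) : EA.add a (EA.diff b a) = some b :=
  Classical.epsilon_spec h

theorem diff_eq (h : EA.add a c = some b) : EA.diff b a = c :=
  add_left_cancel (add_diff ⟨c, h⟩) h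

theorem diff_le (h : EA.le a b) : EA.le (EA.diff b a) b := ⟨a, add_symm (add_diff h)⟩

theorem diff_diff (h : EA.le a b) : EA.diff b (EA.diff b a) = a :=
  diff_eq (add_symm (add_diff h))

/-- For `a ≤ b ≤ c`, the element `c - a` is the sum of `c - b` and `b - a`. -/
theorem diff_add_diff (hab : EA.le a b) (hbc : EA.le b c) :
    EA.add (EA.diff c b) (EA.diff b a) = some (EA.diff c a) := by
  obtain ⟨f, hf, haf⟩ := add_assoc_right (add_diff hab) (add_diff hbc)
  rw [diff_eq haf]
  exact add_symm hf

variable (EA) in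
/-- The order of an effect algebra. -/
@[reducible]
def toPartialOrder : PartialOrder E where
  le := EA.le
  le_refl := EA.le_refl
  le_trans _ _ _ := le_trans
  le_antisymm _ _ := le_antisymm

theorem SigmaLattice.exists_sup (hE : EA.SigmaLattice) (a b : E) : ∃ s, EA.IsSup {a, b} s := by
  obtain ⟨s, hs⟩ := hE.1 fun n => if n = 0 then a else b
  refine ⟨s, ?_, fun c hc => hs.2 c ?_⟩
  · rintro _ (rfl | rfl)
    exacts [hs.1 _ ⟨0, rfl⟩, hs.1 _ ⟨1, rfl⟩]
  · rintro _ ⟨n, rfl⟩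
    dsimp only
    split_ifs
    exacts [hc _ (Or.inl rfl), hc _ (Or.inr rfl)]

theorem SigmaLattice.exists_inf (hE : EA.SigmaLattice) (a b : E) : ∃ s, EA.IsInf {a, b} s := by
  obtain ⟨s, hs⟩ := hE.2 fun n => if n = 0 then a else b
  refine ⟨s, ?_, fun c hc => hs.2 c ?_⟩
  · rintro _ (rfl | rfl)
    exacts [hs.1 _ ⟨0, rfl⟩, hs.1 _ ⟨1, rfl⟩]
  · rintro _ ⟨n, rfl⟩
    dsimp only
    split_ifs
    exacts [hc _ (Or.inl rfl), hc _ (Or.inr rfl)]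

/-- The lattice structure of a σ-lattice effect algebra. -/
@[reducible]
noncomputable def SigmaLattice.toLattice (hE : EA.SigmaLattice) : Lattice E where
  __ := EA.toPartialOrder
  sup a b := (hE.exists_sup a b).choose
  le_sup_left a b := (hE.exists_sup a b).choose_spec.1 _ (Or.inl rfl)
  le_sup_right a b := (hE.exists_sup a b).choose_spec.1 _ (Or.inr rfl)
  sup_le a b c ha hb := (hE.exists_sup a b).choose_spec.2 c (by rintro _ (rfl | rfl) <;> assumption)
  inf a b := (hE.exists_inf a b).choose
  inf_le_left a b := (hE.exists_inf a b).choose_spec.1 _ (Or.inl rfl)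
  inf_le_right a b := (hE.exists_inf a b).choose_spec.1 _ (Or.inr rfl)
  le_inf a b c ha hb := (hE.exists_inf b c).choose_spec.2 a (by rintro _ (rfl | rfl) <;> assumption)

/-- A σ-lattice effect algebra is a difference lattice. -/
@[reducible]
noncomputable def SigmaLattice.toDifferenceLattice (hE : EA.SigmaLattice) : DifferenceLattice E :=
  letI := hE.toLattice
  have diff_inf : ∀ a b : E, b ≤ a → EA.diff a (a ⊓ b) = EA.diff a b := fun a b h => by
    rw [inf_eq_right.2 h]
  { hE.toLattice with
    bot := EA.zero
    bot_le := EA.zero_le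
    top := EA.one
    le_top := EA.le_one
    sub a b := EA.diff a (a ⊓ b)
    sub_inf a b := diff_inf _ _ inf_le_left
    sub_le a b := diff_le (inf_le_left : a ⊓ b ≤ a)
    sub_sub_of_le a b h := by
      change EA.diff a (a ⊓ EA.diff a (a ⊓ b)) = b
      rw [diff_inf a b h, diff_inf _ _ (diff_le h), diff_diff h]
    sub_sub_sub a b c hab hbc := by
      change EA.diff (EA.diff c (c ⊓ a)) (EA.diff c (c ⊓ a) ⊓ EA.diff c (c ⊓ b)) =
        EA.diff b (b ⊓ a)
      have h := diff_add_diff hab hbc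
      rw [diff_inf c a (hab.trans hbc), diff_inf c b hbc, diff_inf b a hab,
        diff_inf _ _ (show EA.le _ _ from ⟨_, h⟩)]
      exact diff_eq h
    sub_le_sub_of_le a b c hab hbc := by
      change EA.le (EA.diff c (c ⊓ b)) (EA.diff c (c ⊓ a))
      rw [diff_inf c a (hab.trans hbc), diff_inf c b hbc]
      exact ⟨_, diff_add_diff hab hbc⟩ }

theorem SigmaLattice.compl_eq (hE : EA.SigmaLattice) (a : E) :
    letI := hE.toDifferenceLattice
    ⊤ - a = EA.diff EA.one a := by
  let := hE.toDifferenceLattice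
  change EA.diff EA.one (⊤ ⊓ a) = _
  rw [top_inf_eq]

/-- The sum of orthogonal elements expressed through the difference. -/
theorem SigmaLattice.add_eq (hE : EA.SigmaLattice)
    (h : letI := hE.toDifferenceLattice; a ≤ ⊤ - b) :
    letI := hE.toDifferenceLattice
    EA.add a b = some (⊤ - ((⊤ - a) - b)) := by
  let := hE.toDifferenceLattice
  have hb : b ≤ ⊤ - a := DifferenceLattice.le_compl_comm h
  have h1 : (⊤ - a) - b = EA.diff (⊤ - a) b := by
    change EA.diff (⊤ - a) ((⊤ - a) ⊓ b) = _
    rw [inf_eq_right.2 hb]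
  have h2 : EA.add b (⊤ - a - b) = some (⊤ - a) := by rw [h1]; exact add_diff hb
  have h3 : EA.add a (⊤ - a) = some EA.one := by rw [hE.compl_eq]; exact add_diff (EA.le_one a)
  obtain ⟨d, hd, hd1⟩ := add_assoc_left h2 h3
  rw [hd, hE.compl_eq, diff_eq (add_symm hd1)]

end EffectAlgebra

namespace Observable

variable {E : Type*} {EA : EffectAlgebra E}

open EffectAlgebra

theorem mono (x : Observable EA) {A B : BorelSet} (h : A.1 ⊆ B.1) :
    EA.le (x.toFun A) (x.toFun B) := by
  refine ⟨x.toFun ⟨B.1 \ A.1, B.2.diff A.2⟩, ?_⟩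
  rw [x.additive _ _ Set.disjoint_sdiff_right]
  congr 2
  exact Subtype.ext (Set.union_sdiff_cancel h)

theorem add_compl (x : Observable EA) (A : BorelSet) :
    EA.add (x.toFun A) (x.toFun ⟨A.1ᶜ, A.2.compl⟩) = some EA.one := by
  rw [x.additive _ _ disjoint_compl_right, ← x.unital]
  congr 2
  exact Subtype.ext (Set.union_compl_self A.1)

theorem isSup_of_iUnion_eq (x : Observable EA) {f : ℕ → BorelSet}
    (hf : ∀ n, (f n).1 ⊆ (f (n + 1)).1) {A : BorelSet} (hA : ⋃ n, (f n).1 = A.1) :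
    EA.IsSup (Set.range fun n => x.toFun (f n)) (x.toFun A) := by
  have h := x.sup_cont f hf
  rwa [show (⟨⋃ n, (f n).1, MeasurableSet.iUnion fun n => (f n).2⟩ : BorelSet) = A from
    Subtype.ext hA] at h

theorem isSup_range (x : Observable EA) :
    EA.IsSup (Set.range fun t => x.toFun (bIio t)) EA.one := by
  refine ⟨by rintro _ ⟨t, rfl⟩; exact EA.le_one _, fun b hb => ?_⟩
  rw [← x.unital]
  refine (x.isSup_of_iUnion_eq (f := fun n => bIio n) (fun n => Set.Iio_subset_Iio (by simp))
    ?_).2 b (by rintro _ ⟨n, rfl⟩; exact hb _ ⟨n, rfl⟩)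
  exact Set.eq_univ_of_forall fun t => Set.mem_iUnion.2 (exists_nat_gt t)

theorem isSup_image_Iio (x : Observable EA) (s : ℝ) :
    EA.IsSup ((fun t => x.toFun (bIio t)) '' Set.Iio s) (x.toFun (bIio s)) := by
  refine ⟨?_, fun b hb => ?_⟩
  · rintro _ ⟨t, ht, rfl⟩
    exact x.mono (Set.Iio_subset_Iio (le_of_lt ht))
  refine (x.isSup_of_iUnion_eq (f := fun n => bIio (s - 1 / (n + 1))) (fun n => ?_) ?_).2 b ?_
  · have := Nat.one_div_le_one_div (α := ℝ) n.le_succ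
    exact Set.Iio_subset_Iio (by linarith)
  · refine Set.Subset.antisymm (Set.iUnion_subset fun n => Set.Iio_subset_Iio ?_) fun t ht => ?_
    · have : (0 : ℝ) < 1 / ((n : ℝ) + 1) := by positivity
      linarith
    · obtain ⟨n, hn⟩ := exists_nat_one_div_lt (sub_pos.2 (Set.mem_Iio.1 ht))
      exact Set.mem_iUnion.2 ⟨n, Set.mem_Iio.2 (by linarith)⟩
  · rintro _ ⟨n, rfl⟩
    refine hb _ ⟨_, ?_, rfl⟩
    have : (0 : ℝ) < 1 / ((n : ℝ) + 1) := by positivity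
    exact Set.mem_Iio.2 (by linarith)

theorem isInf_range (x : Observable EA) :
    EA.IsInf (Set.range fun t => x.toFun (bIio t)) EA.zero := by
  refine ⟨by rintro _ ⟨t, rfl⟩; exact EA.zero_le _, fun b hb => ?_⟩
  obtain ⟨c, hc⟩ := EA.exists_compl b
  have h : EA.le EA.one c := by
    rw [← x.unital]
    refine (x.isSup_of_iUnion_eq (f := fun n => ⟨(Set.Iio (-(n : ℝ)))ᶜ, measurableSet_Iio.compl⟩)
      (fun n => Set.compl_subset_compl.2 (Set.Iio_subset_Iio (by simp))) ?_).2 c ?_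
    · refine Set.eq_univ_of_forall fun t => Set.mem_iUnion.2 ?_
      obtain ⟨n, hn⟩ := exists_nat_gt (-t)
      exact ⟨n, fun h => by linarith [Set.mem_Iio.1 h]⟩
    · rintro _ ⟨n, rfl⟩
      obtain ⟨y, hy⟩ := hb _ ⟨-(n : ℝ), rfl⟩
      obtain ⟨f, hf, hbf⟩ := add_assoc_right hy (x.add_compl (bIio (-n)))
      rw [eq_of_add_eq_one hc hbf]
      exact ⟨y, add_symm hf⟩
  rw [le_antisymm (EA.le_one c) h] at hc
  rw [EA.pos_one b _ hc]
  exact EA.le_refl _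

theorem spectralResolution (x : Observable EA) :
    SpectralResolution EA fun t => x.toFun (bIio t) :=
  ⟨fun _ _ h => x.mono (Set.Iio_subset_Iio h.le), x.isInf_range, x.isSup_range, x.isSup_image_Iio⟩

/-- Observables are determined by their spectral resolution. -/
theorem eq_of_forall_Iio {x y : Observable EA}
    (h : ∀ t, x.toFun (bIio t) = y.toFun (bIio t)) : x = y := by
  have key : ∀ A : Set ℝ, ∀ hA : MeasurableSet A, x.toFun ⟨A, hA⟩ = y.toFun ⟨A, hA⟩ := by
    have hcompl : ∀ A : Set ℝ, ∀ hA : MeasurableSet A, x.toFun ⟨A, hA⟩ = y.toFun ⟨A, hA⟩ →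
        x.toFun ⟨Aᶜ, hA.compl⟩ = y.toFun ⟨Aᶜ, hA.compl⟩ := fun A hA hxy => by
      have h1 := x.add_compl ⟨A, hA⟩
      rw [hxy] at h1
      exact add_left_cancel h1 (y.add_compl ⟨A, hA⟩)
    intro A hA
    induction A, hA using MeasurableSpace.induction_on_inter
      (borel_eq_generateFrom_Iio ℝ ▸ BorelSpace.measurable_eq) isPiSystem_Iio with
    | empty =>
      have h1 := hcompl Set.univ MeasurableSet.univ (x.unital.trans y.unital.symm)
      simpa using h1
    | basic t ht =>
      obtain ⟨t, rfl⟩ := ht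
      exact h t
    | compl t ht ih => exact hcompl t ht ih
    | iUnion f hd hf ih =>
      have hm : ∀ n, MeasurableSet (Set.accumulate f n) := fun n =>
        MeasurableSet.biUnion (Set.to_countable _) fun i _ => hf i
      have hfin : ∀ n, x.toFun ⟨Set.accumulate f n, hm n⟩ = y.toFun ⟨Set.accumulate f n, hm n⟩ := by
        intro n
        induction n with
        | zero => simpa using ih 0
        | succ n ihn =>
          have hdis := Set.disjoint_accumulate hd n.lt_succ_self
          have hx := x.additive ⟨_, hm n⟩ ⟨_, hf (n + 1)⟩ hdis
          have hy := y.additive ⟨_, hm n⟩ ⟨_, hf (n + 1)⟩ hdis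
          rw [ihn, ih, hy] at hx
          simpa only [Set.accumulate_succ] using (Option.some.inj hx).symm
      have hsub : ∀ n, Set.accumulate f n ⊆ Set.accumulate f (n + 1) := fun n =>
        Set.monotone_accumulate n.le_succ
      have hx := x.isSup_of_iUnion_eq (f := fun n => ⟨_, hm n⟩) hsub
        (A := ⟨⋃ n, f n, MeasurableSet.iUnion hf⟩) Set.iUnion_accumulate
      have hy := y.isSup_of_iUnion_eq (f := fun n => ⟨_, hm n⟩) hsub
        (A := ⟨⋃ n, f n, MeasurableSet.iUnion hf⟩) Set.iUnion_accumulate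
      simp only [hfin] at hx
      exact hx.unique hy
  have hfun : x.toFun = y.toFun := funext fun A => key A.1 A.2
  cases x
  cases y
  congr

end Observable

theorem SpectralResolution.exists_observable {E : Type*} {EA : EffectAlgebra E}
    (hE : EA.SigmaLattice) {F : ℝ → E} (hF : SpectralResolution EA F) :
    ∃ x : Observable EA, ∀ t : ℝ, x.toFun (bIio t) = F t := by
  let := hE.toDifferenceLattice
  obtain ⟨hmono, hbot, htop, hleft⟩ := hF
  have hmono' : Monotone F := monotone_iff_forall_lt.2 fun t s h => hmono t s h
  obtain ⟨x, h1, hadd, hsup, hx⟩ := DifferenceLattice.exists_extension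
    (E := E) hE.1 hmono' hbot htop hleft
  refine ⟨⟨x, h1, fun A B hAB => ?_, hsup⟩, hx⟩
  obtain ⟨h2, h3⟩ := hadd A B hAB
  rw [h3]
  exact hE.add_eq h2

/-- spectral resolution theorem: on a σ-lattice effect algebra,
`t ↦ x((-∞,t))` is a spectral resolution for each observable `x`, and every
spectral resolution arises from a unique observable. -/
theorem stmt7 {E : Type*} (EA : EffectAlgebra E) (hE : EA.SigmaLattice) :
    (∀ x : Observable EA, SpectralResolution EA (fun t => x.toFun (bIio t))) ∧
    (∀ F : ℝ → E, SpectralResolution EA F →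
      ∃! x : Observable EA, ∀ t : ℝ, x.toFun (bIio t) = F t) := by
  refine ⟨Observable.spectralResolution, fun F hF => ?_⟩
  obtain ⟨x, hx⟩ := hF.exists_observable hE
  exact ⟨x, hx, fun y hy => Observable.eq_of_forall_Iio fun t => (hy t).trans (hx t).symm⟩
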